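/- Let d > 1 be an integer and let f, g ∈ ℂ[x] be polynomials with deg f = d and deg g = d, and let c ∈ ℂ[x] be a polynomial. Then the set { n ∈ ℕ : there exists x ∈ ℂ with f^n(x) = g^n(x) and g^n(x) = c(x) } is a finite union of arithmetic progressions. -/

import Mathlib

open Polynomial

section

/-- the n-th compositional iterate as a polynomial -/
noncomputable def itr {R : Type*} [CommRing R] (f : R[X]) (n : ℕ) : R[X] := f.comp^[n] X

lemma itr_zero {R : Type*} [CommRing R] (f : R[X]) : itr f 0 = X := rfl

lemma itr_succ {R : Type*} [CommRing R] (f : R[X]) (n : ℕ) :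
    itr f (n+1) = f.comp (itr f n) := by
  simp [itr, Function.iterate_succ_apply']

lemma itr_eval {R : Type*} [CommRing R] (f : R[X]) (n : ℕ) (x : R) :
    (itr f n).eval x = (fun y => f.eval y)^[n] x := by
  simp [itr, iterate_comp_eval]

lemma itr_map {R S : Type*} [CommRing R] [CommRing S] (φ : R →+* S) (f : R[X]) (n : ℕ) :
    (itr f n).map φ = itr (f.map φ) n := by
  induction n with
  | zero => simp [itr_zero]
  | succ n ih => rw [itr_succ, itr_succ, Polynomial.map_comp, ih]

lemma itr_natDegree {R : Type*} [Field R] (f : R[X]) (n : ℕ) :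
    (itr f n).natDegree = f.natDegree ^ n := by
  induction n with
  | zero => simp [itr_zero]
  | succ n ih => rw [itr_succ, natDegree_comp, ih, pow_succ, mul_comm]

lemma itr_monic {R : Type*} [Field R] (f : R[X]) (hf : f.Monic) (hd : f.natDegree ≠ 0) (n : ℕ) :
    (itr f n).Monic := by
  induction n with
  | zero => simp [itr_zero]
  | succ n ih =>
    rw [itr_succ]
    refine hf.comp ih ?_
    rw [itr_natDegree]; positivity

lemma itr_lead_succ {R : Type*} [Field R] (g : R[X]) (hd : g.natDegree ≠ 0) (n : ℕ) :
    (itr g (n+1)).leadingCoeff = g.leadingCoeff * (itr g n).leadingCoeff ^ g.natDegree := by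
  rw [itr_succ, leadingCoeff_comp]
  rw [itr_natDegree]; positivity

lemma itr_lead_ne {R : Type*} [Field R] (g : R[X]) (hd : g.natDegree ≠ 0) (n : ℕ) :
    (itr g n).leadingCoeff ≠ 0 := by
  rw [Ne, leadingCoeff_eq_zero]
  intro h
  have := itr_natDegree g n
  rw [h] at this
  simp at this
  have h2 : 0 < g.natDegree ^ n := by positivity
  omega

/-- difference of normalized iterates -/
noncomputable def hdiff {R : Type*} [Field R] (f g : R[X]) (m : ℕ) : R[X] :=
  itr f m - C ((itr g m).leadingCoeff)⁻¹ * itr g m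

lemma comp_low {R : Type*} [Field R] (r P : R[X]) (d N : ℕ) (hr : r.natDegree ≤ d - 1)
    (hP : P.natDegree ≤ N) : (r.comp P).natDegree ≤ (d-1) * N := by
  rw [natDegree_comp]; gcongr

lemma sum_geom_top {R : Type*} [Field R] (P Q : R[X]) (hP : P.Monic) (hQ : Q.Monic) (N d : ℕ)
    (hPN : P.natDegree = N) (hQN : Q.natDegree = N) :
    (∑ i ∈ Finset.range d, P^i * Q^(d-1-i)).natDegree ≤ (d-1)*N ∧
    (∑ i ∈ Finset.range d, P^i * Q^(d-1-i)).coeff ((d-1)*N) = d := by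
  have key : ∀ i ∈ Finset.range d, (P^i * Q^(d-1-i)).Monic ∧
      (P^i * Q^(d-1-i)).natDegree = (d-1)*N := by
    intro i hi
    have hi := Finset.mem_range.1 hi
    refine ⟨(hP.pow i).mul (hQ.pow _), ?_⟩
    rw [(hP.pow i).natDegree_mul (hQ.pow _), hP.natDegree_pow, hQ.natDegree_pow, hPN, hQN,
      ← add_mul]
    congr 1; omega
  constructor
  · refine natDegree_sum_le_of_forall_le _ _ fun i hi => (key i hi).2.le
  · rw [finsetSum_coeff]
    rw [Finset.sum_congr rfl (g := fun _ => (1:R))]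
    · simp
    · intro i hi
      rw [← (key i hi).2]
      exact (key i hi).1

lemma hdiff_step {R : Type*} [Field R] [CharZero R] (f g : R[X]) (d : ℕ) (hd : 2 ≤ d)
    (hf : f.natDegree = d) (hfm : f.Monic)
    (hg : g.natDegree = d) (m : ℕ) (hm : 1 ≤ (hdiff f g m).natDegree) :
    (hdiff f g (m+1)).natDegree = (d-1) * d^m + (hdiff f g m).natDegree ∧
    (hdiff f g (m+1)).leadingCoeff = d * (hdiff f g m).leadingCoeff := by
  set h := hdiff f g m with hh
  set L := (itr g m).leadingCoeff with hL
  have hL0 : L ≠ 0 := itr_lead_ne g (by omega) m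
  set P := itr f m with hP
  set Q := C L⁻¹ * itr g m with hQ
  have hPm : P.Monic := itr_monic f hfm (by omega) m
  have hPN : P.natDegree = d^m := by rw [hP, itr_natDegree, hf]
  have hQm : Q.Monic := by
    rw [Monic, hQ, leadingCoeff_mul, leadingCoeff_C]; exact inv_mul_cancel₀ hL0
  have hQN : Q.natDegree = d^m := by
    rw [hQ, natDegree_C_mul (inv_ne_zero hL0), itr_natDegree, hg]
  have hPQ : h = P - Q := rfl
  have hb : g.leadingCoeff ≠ 0 := by
    rw [Ne, leadingCoeff_eq_zero]; rintro rfl; simp at hg; omega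
  have hgm : itr g m = C L * Q := by
    rw [hQ, ← mul_assoc, ← C_mul, mul_inv_cancel₀ hL0]; simp
  -- decompose
  have hfd : f = X^d + f.eraseLead := by
    conv_lhs => rw [← eraseLead_add_C_mul_X_pow f]
    rw [hfm.leadingCoeff, hf]; simp [add_comm]
  have hgd : g = C g.leadingCoeff * X^d + g.eraseLead := by
    conv_lhs => rw [← eraseLead_add_C_mul_X_pow g]
    rw [hg]; simp [add_comm]
  have hfe : f.eraseLead.natDegree ≤ d - 1 := by
    have := eraseLead_natDegree_le f; omega
  have hge : g.eraseLead.natDegree ≤ d - 1 := by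
    have := eraseLead_natDegree_le g; omega
  have hL' : (itr g (m+1)).leadingCoeff = g.leadingCoeff * L^d := by
    rw [itr_lead_succ g (by omega), hg]
  have h1 : itr f (m+1) = P^d + f.eraseLead.comp P := by
    rw [itr_succ]
    have := congrArg (fun z => z.comp P) hfd
    simpa only [add_comp, X_pow_comp] using this
  have h2 : C ((itr g (m+1)).leadingCoeff)⁻¹ * itr g (m+1) =
      Q^d + C ((itr g (m+1)).leadingCoeff)⁻¹ * g.eraseLead.comp (itr g m) := by
    have := congrArg (fun z => z.comp (itr g m)) hgd
    simp only [add_comp] at this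
    have h3 : itr g (m+1) = (C g.leadingCoeff * X ^ d).comp (itr g m) +
        g.eraseLead.comp (itr g m) := by rw [itr_succ]; exact this
    have h4 : ∀ u : R[X], u * itr g (m+1) = u * (C g.leadingCoeff * X ^ d).comp (itr g m) +
        u * g.eraseLead.comp (itr g m) := by intro u; rw [h3]; ring
    rw [h4]
    congr 1
    rw [hL', hgm, mul_comp, C_comp, X_pow_comp, mul_pow, ← C_pow, ← mul_assoc, ← mul_assoc,
      ← C_mul, ← C_mul]
    rw [mul_assoc, inv_mul_cancel₀ (mul_ne_zero hb (pow_ne_zero _ hL0))]; simp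
  obtain ⟨hG1, hG2⟩ := sum_geom_top P Q hPm hQm (d^m) d hPN hQN
  set G := ∑ i ∈ Finset.range d, P^i * Q^(d-1-i) with hG
  set E := f.eraseLead.comp P - C ((itr g (m+1)).leadingCoeff)⁻¹ * g.eraseLead.comp (itr g m)
    with hE
  have h3 : hdiff f g (m+1) = G * h + E := by
    rw [hdiff, h1, h2, hPQ, hG, geom_sum₂_mul, hE]; ring
  have hEd : E.natDegree ≤ (d-1) * d^m := by
    refine (natDegree_sub_le _ _).trans (max_le (comp_low _ _ _ _ hfe hPN.le) ?_)
    refine (natDegree_C_mul_le _ _).trans (comp_low _ _ _ _ hge ?_)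
    rw [itr_natDegree, hg]
  have hcoef : (hdiff f g (m+1)).coeff ((d-1) * d^m + h.natDegree) = d * h.leadingCoeff := by
    rw [h3, coeff_add, coeff_mul_add_eq_of_natDegree_le hG1 le_rfl, hG2,
      coeff_eq_zero_of_natDegree_lt (p := E) (by omega)]
    simp
  have hdeg : (hdiff f g (m+1)).natDegree ≤ (d-1) * d^m + h.natDegree := by
    rw [h3]
    refine (natDegree_add_le _ _).trans (max_le ?_ (by omega))
    exact natDegree_mul_le.trans (by omega)
  have hne : (d:R) * h.leadingCoeff ≠ 0 := by
    refine mul_ne_zero (by norm_cast; omega) ?_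
    rw [Ne, leadingCoeff_eq_zero]; intro h0; rw [h0] at hm; simp at hm
  have : (hdiff f g (m+1)).natDegree = (d-1) * d^m + h.natDegree := by
    refine le_antisymm hdeg (le_natDegree_of_ne_zero ?_)
    rw [hcoef]; exact hne
  refine ⟨this, ?_⟩
  rw [leadingCoeff, this, hcoef]

lemma hdiff_growth {R : Type*} [Field R] [CharZero R] (f g : R[X]) (d : ℕ) (hd : 2 ≤ d)
    (hf : f.natDegree = d) (hfm : f.Monic)
    (hg : g.natDegree = d) (m : ℕ) (hm : 1 ≤ (hdiff f g m).natDegree) (j : ℕ) :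
    1 ≤ (hdiff f g (m+j)).natDegree ∧
    (hdiff f g (m+j)).leadingCoeff = d^j * (hdiff f g m).leadingCoeff := by
  induction j with
  | zero => simp [hm]
  | succ j ih =>
    obtain ⟨h1, h2⟩ := hdiff_step f g d hd hf hfm hg (m+j) ih.1
    rw [← add_assoc]
    refine ⟨by omega, ?_⟩
    rw [h2, ih.2]; ring
end

section

lemma eval_norm_le (c : ℂ[X]) (e : ℕ) (hc : c.natDegree ≤ e) (B : ℝ) (hB : 0 ≤ B)
    (hcB : ∀ i, ‖c.coeff i‖ ≤ B) (x : ℂ) (R : ℝ) (hR : 1 ≤ R) (hx : ‖x‖ ≤ R) :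
    ‖c.eval x‖ ≤ (e+1) * B * R^e := by
  rw [eval_eq_sum_range' (Nat.lt_succ_of_le hc)]
  refine (norm_sum_le _ _).trans ?_
  have : ∀ i ∈ Finset.range (e+1), ‖c.coeff i * x^i‖ ≤ B * R^e := by
    intro i hi
    rw [norm_mul, norm_pow]
    have hi : i ≤ e := by simpa [Nat.lt_succ_iff] using hi
    gcongr
    · exact hcB i
    · exact (pow_le_pow_left₀ (norm_nonneg _) hx i).trans (pow_le_pow_right₀ hR hi)
  refine (Finset.sum_le_sum this).trans ?_
  simp [mul_assoc]

lemma escape_step (d : ℕ) (hd : 2 ≤ d) (f : ℂ[X]) (hf : f.natDegree = d) (B : ℝ) (hB : 1 ≤ B)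
    (hfB : ∀ i, ‖f.coeff i‖ ≤ B) (hl : 1 ≤ B * ‖f.leadingCoeff‖) (u : ℂ)
    (hu : 2 * d * B^2 ≤ ‖u‖) : (‖u‖/(2*B))^2 ≤ ‖f.eval u‖ / (2*B) := by
  have hd' : (2:ℝ) ≤ d := by exact_mod_cast hd
  have hu1 : 1 ≤ ‖u‖ := by nlinarith
  have hu2 : 2 * B ≤ ‖u‖ := by nlinarith
  have e1 : f.eval u = f.eraseLead.eval u + f.leadingCoeff * u^d := by
    conv_lhs => rw [← eraseLead_add_C_mul_X_pow f]
    rw [hf]; simp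
  obtain ⟨m, rfl⟩ : ∃ m, d = m + 1 := ⟨d-1, by omega⟩
  have e2 : ‖f.eraseLead.eval u‖ ≤ ((m:ℝ)+1) * B * ‖u‖^m := by
    refine eval_norm_le _ m ?_ B (by linarith) ?_ u _ hu1 le_rfl
    · have := eraseLead_natDegree_le f; omega
    · intro i
      rw [eraseLead_coeff]
      split_ifs
      · simp; linarith
      · exact hfB i
  have e3 : ‖u‖^(m+1) ≤ B * ‖f.leadingCoeff * u^(m+1)‖ := by
    rw [norm_mul, norm_pow, ← mul_assoc]
    exact le_mul_of_one_le_left (by positivity) hl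
  have e4 : ‖f.leadingCoeff * u^(m+1)‖ - ‖f.eraseLead.eval u‖ ≤ ‖f.eval u‖ := by
    rw [e1, add_comm (f.eraseLead.eval u)]
    have := norm_sub_le (f.leadingCoeff * u^(m+1) + f.eraseLead.eval u) (f.eraseLead.eval u)
    rw [add_sub_cancel_right] at this; linarith
  have e5 : ‖u‖^(m+1) ≤ 2 * B * ‖f.eval u‖ := by
    have : 2 * B * (((m:ℝ)+1) * B * ‖u‖^m) ≤ ‖u‖^(m+1) := by
      rw [pow_succ]
      push_cast at hu
      have : 0 ≤ ‖u‖^m := by positivity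
      nlinarith
    nlinarith
  have e6 : ‖u‖^2 ≤ ‖u‖^(m+1) := pow_le_pow_right₀ hu1 hd
  rw [div_pow, div_le_div_iff₀ (by positivity) (by positivity)]
  nlinarith [norm_nonneg (f.eval u)]

lemma escape_iter (d : ℕ) (hd : 2 ≤ d) (f : ℂ[X]) (hf : f.natDegree = d) (B : ℝ) (hB : 1 ≤ B)
    (hfB : ∀ i, ‖f.coeff i‖ ≤ B) (hl : 1 ≤ B * ‖f.leadingCoeff‖) (u : ℂ)
    (hu : 2 * d * B^2 ≤ ‖u‖) (k : ℕ) :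
    2 * d * B^2 ≤ ‖(fun y => f.eval y)^[k] u‖ ∧
    (‖u‖/(2*B))^(k+1) ≤ ‖(fun y => f.eval y)^[k] u‖ / (2*B) := by
  have hd' : (2:ℝ) ≤ d := by exact_mod_cast hd
  induction k with
  | zero => simp [hu]
  | succ k ih =>
    have h1 := escape_step d hd f hf B hB hfB hl _ ih.1
    rw [Function.iterate_succ_apply']
    set v := (fun y => f.eval y)^[k] u
    have hw : 1 ≤ ‖u‖/(2*B) := by
      rw [le_div_iff₀ (by positivity)]; nlinarith
    have hv : 1 ≤ ‖v‖/(2*B) := by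
      rw [le_div_iff₀ (by positivity)]; nlinarith [ih.1]
    constructor
    · refine ih.1.trans ?_
      have : ‖v‖/(2*B) ≤ ‖f.eval v‖ / (2*B) := le_trans (by nlinarith) h1
      exact (div_le_div_iff_of_pos_right (by positivity)).1 this
    · refine le_trans ?_ h1
      calc (‖u‖/(2*B))^(k+1+1) ≤ (‖u‖/(2*B))^((k+1)*2) := pow_le_pow_right₀ hw (by omega)
        _ = ((‖u‖/(2*B))^(k+1))^2 := pow_mul _ _ _
        _ ≤ _ := pow_le_pow_left₀ (by positivity) ih.2 2

lemma escape (d e : ℕ) (hd : 2 ≤ d) : ∃ (C : ℝ) (κ : ℕ), 1 ≤ C ∧ ∀ B : ℝ, 1 ≤ B → ∀ f c : ℂ[X],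
    f.natDegree = d → c.natDegree ≤ e → (∀ i, ‖f.coeff i‖ ≤ B) → (∀ i, ‖c.coeff i‖ ≤ B) →
    1 ≤ B * ‖f.leadingCoeff‖ → ∀ n, e + 1 ≤ n → ∀ x : ℂ,
    (fun y => f.eval y)^[n] x = c.eval x → ∀ k ≤ n, ‖(fun y => f.eval y)^[k] x‖ ≤ C * B^κ := by
  set D : ℝ := 2 * d + 2 * (e+1) * 2^e with hD
  have hd' : (2:ℝ) ≤ d := by exact_mod_cast hd
  have hD1 : 1 ≤ D := by have : (0:ℝ) ≤ 2 * (e+1) * 2^e := by positivity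
                         linarith
  refine ⟨(e+2) * D^(e+1), (e+2)*(e+1)+1, ?_, ?_⟩
  · have : 1 ≤ D^(e+1) := one_le_pow₀ hD1
    have : (0:ℝ) ≤ e := by positivity
    nlinarith
  intro B hB f c hf hc hfB hcB hl n hn x hx k hk
  set R := D * B^(e+2) with hR
  have hBe : B^2 ≤ B^(e+2) := pow_le_pow_right₀ hB (by omega)
  have hBe1 : 1 ≤ B^(e+2) := one_le_pow₀ hB
  have hR1 : 1 ≤ R := by rw [hR]; nlinarith
  have hR0 : 2 * d * B^2 ≤ R := by
    have : (0:ℝ) ≤ 2 * (e+1) * 2^e := by positivity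
    have : 2 * d * B^2 ≤ 2 * d * B^(e+2) := by gcongr
    have : 0 ≤ 2 * (e+1) * 2^e * B^(e+2) := by positivity
    rw [hR, hD]; nlinarith
  have hR2 : 2 * B * ((e+1) * (2*B)^e) ≤ R := by
    have h1 : 2 * B * ((e+1) * (2*B)^e) = 2 * (e+1) * 2^e * B^(e+1) := by rw [mul_pow]; ring
    have h2 : B^(e+1) ≤ B^(e+2) := pow_le_pow_right₀ hB (by omega)
    have h3 : 2 * (e+1) * 2^e * B^(e+1) ≤ 2 * (e+1) * 2^e * B^(e+2) := by gcongr
    have : 0 ≤ 2 * d * B^(e+2) := by positivity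
    rw [h1, hR, hD]; nlinarith
  have hxR : ‖x‖ ≤ R := by
    by_contra! hcon
    have h1 := (escape_iter d hd f hf B hB hfB hl x (hR0.trans hcon.le) n).2
    set w := ‖x‖/(2*B) with hw
    have hxw : ‖x‖ = 2 * B * w := by rw [hw]; field_simp
    have hw1 : (e+1) * (2*B)^e < w := by
      rw [hw, lt_div_iff₀ (by positivity)]; linarith
    have hw2 : 1 ≤ w := by
      have : (1:ℝ) ≤ (2*B)^e := one_le_pow₀ (by linarith)
      have : (0:ℝ) ≤ e := by positivity
      nlinarith
    rw [hx] at h1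
    have h2 := eval_norm_le c e hc B (by linarith) hcB x _ (by linarith) le_rfl
    rw [le_div_iff₀ (by positivity)] at h1
    have h3 : w^(e+2) ≤ w^(n+1) := pow_le_pow_right₀ hw2 (by omega)
    have h4 : w^(e+2) * (2*B) ≤ (e+1)*B*‖x‖^e := by nlinarith
    rw [hxw, mul_pow] at h4
    have h5 : w^e * (2 * w^2) * B ≤ w^e * ((e+1) * (2*B)^e) * B := by
      calc w^e * (2 * w^2) * B = w^(e+2) * (2*B) := by ring
        _ ≤ _ := h4
        _ = _ := by ring
    have h6 : 2 * w^2 ≤ (e+1) * (2*B)^e := by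
      have := le_of_mul_le_mul_right h5 (by linarith)
      exact le_of_mul_le_mul_left this (by positivity)
    nlinarith
  have hcx : ‖c.eval x‖ ≤ (e+1) * B * R^e := eval_norm_le c e hc B (by linarith) hcB x R hR1 hxR
  have hgoal : (e+2) * D^(e+1) * B^((e+2)*(e+1)+1) = (e+2) * B * R^(e+1) := by
    rw [hR, mul_pow, ← pow_mul]; ring
  rw [hgoal]
  by_contra! hcon
  set u := (fun y => f.eval y)^[k] x with hu
  have hRe : R ≤ R^(e+1) := le_self_pow₀ hR1 (by omega)
  have hRe' : R^e ≤ R^(e+1) := pow_le_pow_right₀ hR1 (by omega)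
  have hBR : R^(e+1) ≤ (e+2)*B*R^(e+1) := by
    refine le_mul_of_one_le_left (by positivity) ?_
    have : (0:ℝ) ≤ e := by positivity
    nlinarith
  have h1 := (escape_iter d hd f hf B hB hfB hl u (by linarith) (n-k)).2
  have h2 : (fun y => f.eval y)^[n-k] u = c.eval x := by
    rw [hu, ← Function.iterate_add_apply, Nat.sub_add_cancel hk, hx]
  rw [h2] at h1
  have hw : 1 ≤ ‖u‖/(2*B) := by
    rw [le_div_iff₀ (by positivity)]; nlinarith
  have h3 : ‖u‖/(2*B) ≤ ‖c.eval x‖/(2*B) := (le_self_pow₀ hw (by omega)).trans h1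
  have h4 := (div_le_div_iff_of_pos_right (by positivity)).1 h3
  have h5 : (e+1) * B * R^e ≤ (e+2)*B*R^(e+1) := by
    have : (0:ℝ) ≤ e := by positivity
    gcongr
    linarith
  linarith
end

section

/-- leading coefficient bounded by sup on the unit circle -/
lemma lead_le_sup (p : ℂ[X]) (S : ℝ) (h : ∀ x : ℂ, ‖x‖ = 1 → ‖p.eval x‖ ≤ S) :
    ‖p.leadingCoeff‖ ≤ S := by
  have h1 : ‖p.reverse.eval 0‖ ≤ S := by
    refine Complex.norm_le_of_forall_mem_frontier_norm_le (U := Metric.ball 0 1) (f := fun z => p.reverse.eval z)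
      Metric.isBounded_ball ?_ ?_ ?_
    · exact (Polynomial.differentiable _).diffContOnCl
    · intro z hz
      rw [frontier_ball _ one_ne_zero] at hz
      have hz1 : ‖z‖ = 1 := by simpa using hz
      have hz0 : z ≠ 0 := by rintro rfl; simp at hz1
      have hinv : ‖z⁻¹‖ = 1 := by simp [hz1]
      letI : Invertible z⁻¹ := ⟨z, by simp [hz0], by simp [hz0]⟩
      have := eval₂_reverse_mul_pow (RingHom.id ℂ) z⁻¹ p
      have hio : ⅟(z⁻¹) = z := rfl
      rw [hio] at this
      have h2 : ‖p.reverse.eval z‖ = ‖p.eval z⁻¹‖ := by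
        have h3 := congrArg norm this
        simpa [eval₂_id, hz1, ← eval₂_eq_eval_map] using h3
      simpa [h2] using h _ hinv
    · exact subset_closure (by simp)
  simpa [← coeff_zero_eq_eval_zero] using h1

lemma one_var (ε : ℝ) (hε : 0 < ε) : ∃ q : ℕ, 1 ≤ q ∧ ∀ (p : ℂ[X]) (t : ℂ) (S s : ℝ),
    (∀ x, ‖x - t‖ ≤ 2 → ‖p.eval x‖ ≤ S) → (∀ x, ‖x - t‖ ≤ ε → ‖p.eval x‖ ≤ s) →
    ‖p.leadingCoeff‖^q ≤ S^(q-1) * s := by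
  obtain ⟨U, hU, hUf, hcov⟩ := (isCompact_sphere (0:ℂ) 1).finite_cover_balls hε
  lift U to Finset ℂ using hUf
  have hUn : U.Nonempty := by
    have : (1:ℂ) ∈ Metric.sphere (0:ℂ) 1 := by simp
    have := hcov this
    simp only [Set.mem_iUnion] at this
    obtain ⟨i, hi, _⟩ := this
    exact ⟨i, hi⟩
  refine ⟨U.card, Finset.card_pos.2 hUn, ?_⟩
  intro p t S s hS hs
  have hU1 : ∀ u ∈ U, ‖u‖ = 1 := fun u hu => by simpa using hU hu
  have hS0 : 0 ≤ S := (norm_nonneg _).trans (hS t (by simp))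
  set P : ℂ[X] := ∏ u ∈ U, p.comp (C u⁻¹ * X + C (t - 1)) with hP
  have hl : ‖P.leadingCoeff‖ = ‖p.leadingCoeff‖^U.card := by
    rw [hP, leadingCoeff_prod, norm_prod]
    rw [Finset.prod_congr rfl (g := fun _ => ‖p.leadingCoeff‖)]
    · simp
    · intro u hu
      have hu0 : u ≠ 0 := by rintro rfl; simpa using hU1 _ hu
      rw [leadingCoeff_comp, leadingCoeff_linear (inv_ne_zero hu0), norm_mul, norm_pow, norm_inv, hU1 u hu]
      · simp
      · rw [natDegree_linear (inv_ne_zero hu0)]; exact one_ne_zero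
  rw [← hl]
  refine lead_le_sup P _ fun x hx => ?_
  have hx' : x ∈ Metric.sphere (0:ℂ) 1 := by simpa using hx
  have := hcov hx'
  simp only [Set.mem_iUnion] at this
  obtain ⟨v, hv, hxv⟩ := this
  have hv : v ∈ U := hv
  rw [hP, eval_prod, norm_prod, ← Finset.mul_prod_erase _ _ hv, mul_comm]
  rw [← Finset.card_erase_of_mem hv]
  refine mul_le_mul ?_ ?_ (norm_nonneg _) (by positivity)
  · rw [← Finset.prod_const]
    refine Finset.prod_le_prod (fun _ _ => norm_nonneg _) ?_
    intro u hu
    have hu := Finset.mem_of_mem_erase hu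
    rw [eval_comp]
    refine hS _ ?_
    simp only [eval_add, eval_mul, eval_C, eval_X]
    have : u⁻¹ * x + (t - 1) - t = u⁻¹ * x - 1 := by ring
    rw [this]
    refine (norm_sub_le _ _).trans ?_
    rw [norm_mul, norm_inv, hU1 u hu, hx]; norm_num
  · rw [eval_comp]
    refine hs _ ?_
    have hv0 : v ≠ 0 := by rintro rfl; simpa using hU1 _ hv
    simp only [eval_add, eval_mul, eval_C, eval_X]
    have : v⁻¹ * x + (t - 1) - t = v⁻¹ * (x - v) := by field_simp; ring
    rw [this, norm_mul, norm_inv, hU1 v hv, inv_one, one_mul]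
    rw [Metric.mem_ball, dist_eq_norm] at hxv
    exact hxv.le

lemma int_poly_lower (ε : ℝ) (hε : 0 < ε) (hε2 : ε ≤ 2) (r : ℕ) : ∃ K : ℕ, ∀ (t : Fin r → ℂ)
    (Z : MvPolynomial (Fin r) ℤ) (S s : ℝ), Z ≠ 0 → 1 ≤ S →
    (∀ τ : Fin r → ℂ, (∀ i, ‖τ i - t i‖ ≤ 2) → ‖MvPolynomial.aeval τ Z‖ ≤ S) →
    (∀ τ : Fin r → ℂ, (∀ i, ‖τ i - t i‖ ≤ ε) → ‖MvPolynomial.aeval τ Z‖ ≤ s) →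
    1 ≤ S^K * s := by
  obtain ⟨q, hq, hone⟩ := one_var ε hε
  induction r with
  | zero =>
    refine ⟨0, fun t Z S s hZ hS h1 h2 => ?_⟩
    have := h2 t (fun i => i.elim0)
    obtain ⟨z, rfl⟩ := MvPolynomial.C_surjective (Fin 0) Z
    have hz : z ≠ 0 := by rintro rfl; simp at hZ
    simp only [MvPolynomial.aeval_C, pow_zero, one_mul] at this ⊢
    refine le_trans ?_ this
    simp only [algebraMap_int_eq, eq_intCast, Complex.norm_intCast]
    exact_mod_cast Int.one_le_abs hz
  | succ r ih =>
    obtain ⟨K, hK⟩ := ih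
    refine ⟨q * K + (q-1), fun t Z S s hZ hS h1 h2 => ?_⟩
    set P := MvPolynomial.finSuccEquiv ℤ r Z with hP
    have hP0 : P ≠ 0 := by
      rw [hP]; simpa using hZ
    set W := P.leadingCoeff with hW
    have hW0 : W ≠ 0 := by simpa [hW] using hP0
    -- slice
    have hslice : ∀ (τ : Fin r → ℂ) (x : ℂ),
        (P.map (MvPolynomial.aeval τ : MvPolynomial (Fin r) ℤ →ₐ[ℤ] ℂ).toRingHom).eval x =
        MvPolynomial.aeval (Fin.cons x τ : Fin (r+1) → ℂ) Z := by
      intro τ x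
      rw [hP]
      have : ((Polynomial.evalRingHom x).comp (Polynomial.mapRingHom
         (MvPolynomial.aeval τ : MvPolynomial (Fin r) ℤ →ₐ[ℤ] ℂ).toRingHom)).comp
         (MvPolynomial.finSuccEquiv ℤ r).toRingEquiv.toRingHom =
         (MvPolynomial.aeval (Fin.cons x τ : Fin (r+1) → ℂ) : MvPolynomial (Fin (r+1)) ℤ →ₐ[ℤ] ℂ).toRingHom := by
        apply MvPolynomial.ringHom_ext
        · intro z; simp
        · intro i
          refine Fin.cases ?_ (fun j => ?_) i
          · simp [MvPolynomial.finSuccEquiv_X_zero]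
          · simp [MvPolynomial.finSuccEquiv_X_succ]
      exact congrArg (fun φ => φ Z) this
    have hlead : ∀ τ : Fin r → ℂ, ∀ S' s' : ℝ, 0 ≤ S' → 0 ≤ s' →
       (∀ x, ‖x - t 0‖ ≤ 2 → ‖MvPolynomial.aeval (Fin.cons x τ : Fin (r+1) → ℂ) Z‖ ≤ S') →
       (∀ x, ‖x - t 0‖ ≤ ε → ‖MvPolynomial.aeval (Fin.cons x τ : Fin (r+1) → ℂ) Z‖ ≤ s') →
       ‖MvPolynomial.aeval τ (W^q)‖ ≤ S'^(q-1) * s' := by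
      intro τ S' s' hS' hs' a1 a2
      by_cases hz : MvPolynomial.aeval τ W = 0
      · rw [map_pow, hz, zero_pow (by omega), norm_zero]; positivity
      · have := hone (P.map (MvPolynomial.aeval τ : MvPolynomial (Fin r) ℤ →ₐ[ℤ] ℂ).toRingHom)
          (t 0) S' s' (fun x hx => by rw [hslice]; exact a1 x hx)
          (fun x hx => by rw [hslice]; exact a2 x hx)
        rw [leadingCoeff_map_of_leadingCoeff_ne_zero _ hz] at this
        rw [map_pow, norm_pow]; exact this
    have hs0 : 0 ≤ s := (norm_nonneg _).trans (h2 t (fun i => by simp [hε.le]))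
    have hcons : ∀ (τ : Fin r → ℂ) (x : ℂ) (b : ℝ), (∀ i : Fin r, ‖τ i - t i.succ‖ ≤ b) → ‖x - t 0‖ ≤ b →
        ∀ i, ‖(Fin.cons x τ : Fin (r+1) → ℂ) i - t i‖ ≤ b := by
      intro τ x b ha hb i
      refine Fin.cases ?_ (fun j => ?_) i
      · simpa using hb
      · simpa using ha j
    · have := hK (fun i => t i.succ) (W^q) (S^q) (S^(q-1) * s) (pow_ne_zero _ hW0) (one_le_pow₀ hS)
        (fun τ hτ => by
          have := hlead τ S S (by linarith) (by linarith) (fun x hx => h1 _ (hcons τ x 2 hτ hx))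
            (fun x hx => h1 _ (hcons τ x 2 hτ (hx.trans hε2)))
          rwa [← pow_succ, Nat.sub_add_cancel hq] at this)
        (fun τ hτ => hlead τ S s (by linarith) hs0
          (fun x hx => h1 _ (hcons τ x 2 (fun i => (hτ i).trans hε2) hx))
          (fun x hx => h2 _ (hcons τ x ε hτ hx)))
      rwa [← pow_mul, ← mul_assoc, ← pow_add] at this
end

section

lemma disc_exists (P : ℂ[X]) (hP : P.Monic) (n : ℕ) (hn : P.derivative.natDegree ≤ n) :
    ∃ y : Fin P.natDegree → ℂ, (∀ i, P.IsRoot (y i)) ∧ ∃ s : ℂ, (s = 1 ∨ s = -1) ∧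
      resultant P P.derivative P.natDegree n = s * (Matrix.vandermonde y).det ^ 2 := by
  classical
  have hsp : P.Splits := IsAlgClosed.splits P
  have hcard : P.roots.card = P.natDegree := hsp.natDegree_eq_card_roots.symm
  obtain ⟨l, hl⟩ := Quot.exists_rep P.roots
  have hl' : (l : Multiset ℂ) = P.roots := hl
  have hlen : l.length = P.natDegree := by rw [← hcard, ← hl']; rfl
  let y : Fin P.natDegree → ℂ := fun i => l.get (i.cast hlen.symm)
  have hy : P.roots = Finset.univ.val.map y := by
    have h1 : List.ofFn y = l := by
      apply List.ext_get
      · simp [hlen]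
      · intro k h1 h2
        simp [y]
    rw [← hl', ← h1]
    simp [Fin.univ_def, List.ofFn_eq_map]
  have hprod : P = ∏ i, (X - C (y i)) := by
    conv_lhs => rw [hsp.eq_prod_roots_of_monic hP, hy]
    simp [Finset.prod]
    rfl
  refine ⟨y, fun i => ?_, ?_⟩
  · have : y i ∈ P.roots := by rw [hy]; simp
    exact (mem_roots'.1 this).2
  · have hder : ∀ i, P.derivative.eval (y i) = ∏ j ∈ Finset.univ.erase i, (y i - y j) := by
      intro i
      conv_lhs => rw [hprod]
      rw [derivative_prod_finset, eval_finsetSum, Finset.sum_eq_single i]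
      · simp [eval_prod]
      · intro j _ hj
        simp only [derivative_X_sub_C, mul_one, eval_prod]
        apply Finset.prod_eq_zero (i := i)
        · simp [Ne.symm hj]
        · simp
      · simp
    have h1 : resultant P P.derivative P.natDegree n = ∏ i, ∏ j ∈ Finset.univ.erase i, (y i - y j) := by
      rw [resultant_eq_prod_eval _ _ _ hn hsp, hP.leadingCoeff, one_pow, one_mul, hy, Multiset.map_map]
      exact Finset.prod_congr rfl fun i _ => hder i
    have h2 := Finset.prod_prod_Ioi_mul_eq_prod_prod_off_diag (fun i j => (y i - y j))
    have h3 : ∀ i, ∏ j ∈ Finset.univ.erase i, (y i - y j) = ∏ j ∈ ({i} : Finset _)ᶜ, (y j - y i) * (-1) := by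
      intro i
      apply Finset.prod_congr
      · ext; simp
      · intros; ring
    rw [h1]
    have h4 : ∀ i, ∏ j ∈ Finset.univ.erase i, (y i - y j) = ∏ j ∈ ({i} : Finset _)ᶜ, (y i - y j) := by
      intro i
      apply Finset.prod_congr
      · ext; simp
      · intros; ring
    have h5 : ∃ s : ℂ, (s = 1 ∨ s = -1) ∧ ∏ i, ∏ j ∈ Finset.Ioi i, (y i - y j) * (y j - y i) = s * (∏ i, ∏ j ∈ Finset.Ioi i, (y j - y i))^2 := by
      refine ⟨∏ i : Fin P.natDegree, ∏ j ∈ Finset.Ioi i, (-1), ?_, ?_⟩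
      · have : ∀ (s : Finset (Fin P.natDegree)) , (∏ i ∈ s, ∏ j ∈ Finset.Ioi i, (-1 : ℂ)) = 1 ∨ (∏ i ∈ s, ∏ j ∈ Finset.Ioi i, (-1 : ℂ)) = -1 := by
          intro s
          simp only [Finset.prod_const, Finset.prod_pow_eq_pow_sum]
          exact neg_one_pow_eq_or ℂ _
        exact this _
      · rw [← Finset.prod_pow, ← Finset.prod_mul_distrib]
        apply Finset.prod_congr rfl
        intro i _
        rw [← Finset.prod_pow, ← Finset.prod_mul_distrib]
        apply Finset.prod_congr rfl
        intro j _
        ring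
    obtain ⟨s, hs, h5⟩ := h5
    refine ⟨s, hs, ?_⟩
    rw [Matrix.det_vandermonde, ← h5]
    have h6 : (∏ i, ∏ j ∈ Finset.univ.erase i, (y i - y j)) = ∏ i, ∏ j ∈ ({i} : Finset (Fin P.natDegree))ᶜ, (y j - y i) := by
      rw [Finset.prod_comm' (t' := Finset.univ) (s' := fun j => ({j} : Finset _)ᶜ)]
      intro a b; simp [eq_comm]
    rw [h6, ← h2]
    exact Finset.prod_congr rfl fun i _ => Finset.prod_congr rfl fun j _ => mul_comm _ _

/-- determinant bound -/
lemma det_norm_le {M : ℕ} (A : Matrix (Fin M) (Fin M) ℂ) (b : Fin M → ℝ)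
    (h : ∀ i j, ‖A i j‖ ≤ b j) : ‖A.det‖ ≤ (M.factorial : ℝ) * ∏ j, b j := by
  rw [Matrix.det_apply]
  refine (norm_sum_le _ _).trans ?_
  have : ∀ σ ∈ (Finset.univ : Finset (Equiv.Perm (Fin M))), ‖Equiv.Perm.sign σ • ∏ i, A (σ i) i‖ ≤ ∏ j, b j := by
    intro σ _
    have h1 : ‖Equiv.Perm.sign σ • ∏ i, A (σ i) i‖ = ‖∏ i, A (σ i) i‖ := by
      rcases Int.units_eq_one_or (Equiv.Perm.sign σ) with h | h <;> simp [h]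
    rw [h1, norm_prod]
    exact Finset.prod_le_prod (fun _ _ => norm_nonneg _) fun i _ => h _ _
  refine (Finset.sum_le_card_nsmul _ _ _ this).trans ?_
  simp [Finset.card_univ, Fintype.card_perm]

lemma det_isIntegral {A : Type*} [CommRing A] [Algebra A ℂ] {M : ℕ} (W : Matrix (Fin M) (Fin M) ℂ)
    (h : ∀ i j, IsIntegral A (W i j)) : IsIntegral A W.det := by
  rw [Matrix.det_apply]
  refine IsIntegral.sum _ fun σ _ => ?_
  have : IsIntegral A (∏ i, W (σ i) i) := IsIntegral.prod _ fun i _ => h _ _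
  rcases Int.units_eq_one_or (Equiv.Perm.sign σ) with h | h
  · simpa [h] using this
  · simpa [h] using this.neg

/-- rows `x^(k % D) T^(k / D)`. -/
noncomputable def rowp (T : ℂ[X]) (k : ℕ) : ℂ[X] := X ^ (k % T.natDegree) * T ^ (k / T.natDegree)

lemma rowp_natDegree (T : ℂ[X]) (hT : T.Monic) (k : ℕ) : (rowp T k).natDegree = k := by
  unfold rowp
  rw [Monic.natDegree_mul (monic_X_pow _) (hT.pow _), natDegree_X_pow, hT.natDegree_pow]
  rw [mul_comm]
  exact Nat.mod_add_div k T.natDegree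

lemma rowp_monic (T : ℂ[X]) (hT : T.Monic) (k : ℕ) : (rowp T k).Monic :=
  (monic_X_pow _).mul (hT.pow _)

lemma vand_rowp {M : ℕ} (y : Fin M → ℂ) (T : ℂ[X]) (hT : T.Monic) :
    (Matrix.vandermonde y).det = (Matrix.of fun i j : Fin M => (rowp T j).eval (y i)).det :=
  Matrix.det_eval_matrixOfPolynomials_eq_det_vandermonde y (fun j => rowp T j)
    (fun i => rowp_natDegree T hT i) fun i => rowp_monic T hT i

lemma vand_scale {M : ℕ} (y : Fin M → ℂ) (T : ℂ[X]) (hT : T.Monic) (L : ℂ) (e : ℕ) :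
    L ^ (M * e) * (Matrix.vandermonde y).det =
      (Matrix.of fun i j : Fin M => L ^ e * (rowp T j).eval (y i)).det := by
  rw [vand_rowp y T hT]
  have : (Matrix.of fun i j : Fin M => L ^ e * (rowp T j).eval (y i)) =
      (L ^ e) • (Matrix.of fun i j : Fin M => (rowp T j).eval (y i)) := by
    ext i j; simp
  rw [this, Matrix.det_smul, Fintype.card_fin, ← pow_mul, mul_comm e]

lemma row_exp {M N : ℕ} (hN : 0 < N) (k : Fin M) : (k : ℕ) % N + k / N ≤ N + M / N := by
  have h1 := Nat.mod_lt (k : ℕ) hN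
  have h2 : (k : ℕ) / N ≤ M / N := Nat.div_le_div_right k.2.le
  omega

lemma row_split (L y T : ℂ) (i j e : ℕ) (h : i + j ≤ e) :
    L ^ e * (y ^ i * T ^ j) = L ^ (e - (i + j)) * (L * y) ^ i * (L * T) ^ j := by
  obtain ⟨q, rfl⟩ := Nat.exists_eq_add_of_le h
  rw [Nat.add_sub_cancel_left]; ring

lemma vand_integral {A : Type*} [CommRing A] [Algebra A ℂ] {M : ℕ} (y : Fin M → ℂ) (T : ℂ[X])
    (hT : T.Monic) (hN : 0 < T.natDegree) (L : ℂ) (hL : IsIntegral A L)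
    (h1 : ∀ i, IsIntegral A (L * y i)) (h2 : ∀ i, IsIntegral A (L * T.eval (y i))) :
    IsIntegral A (L ^ (M * (T.natDegree + M / T.natDegree)) * (Matrix.vandermonde y).det) := by
  rw [vand_scale y T hT]
  refine det_isIntegral _ fun i j => ?_
  simp only [Matrix.of_apply, rowp, eval_mul, eval_pow, eval_X]
  rw [row_split _ _ _ _ _ _ (row_exp hN j)]
  exact ((hL.pow _).mul ((h1 i).pow _)).mul ((h2 i).pow _)

lemma vand_bound {M : ℕ} (y : Fin M → ℂ) (T : ℂ[X])
    (hT : T.Monic) (hN : 0 < T.natDegree) (L : ℂ) (B : ℝ) (hB : 1 ≤ B) (hL : ‖L‖ ≤ B)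
    (h1 : ∀ i, ‖L * y i‖ ≤ B) (h2 : ∀ i, ‖L * T.eval (y i)‖ ≤ B) :
    ‖L ^ (M * (T.natDegree + M / T.natDegree)) * (Matrix.vandermonde y).det‖ ≤
      M.factorial * B ^ (M * (T.natDegree + M / T.natDegree)) := by
  rw [vand_scale y T hT]
  refine (det_norm_le _ (fun _ => B ^ (T.natDegree + M / T.natDegree)) fun i j => ?_).trans ?_
  · simp only [Matrix.of_apply, rowp, eval_mul, eval_pow, eval_X]
    have h := row_exp hN j
    rw [row_split _ _ _ _ _ _ h, norm_mul, norm_mul, norm_pow, norm_pow, norm_pow]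
    obtain ⟨q, hq⟩ := Nat.exists_eq_add_of_le h
    rw [hq, Nat.add_sub_cancel_left]
    calc _ ≤ B ^ q * B ^ ((j : ℕ) % T.natDegree) * B ^ ((j : ℕ) / T.natDegree) := by
          gcongr
          · exact h1 i
          · exact h2 i
      _ = _ := by ring
  · simp [← pow_mul, mul_comm]

lemma vand_bound_near {M : ℕ} (y : Fin M → ℂ) (T : ℂ[X])
    (hT : T.Monic) (hN : 0 < T.natDegree) (R : ℝ) (hR : 1 ≤ R)
    (h1 : ∀ i, ‖y i‖ ≤ R) (h2 : ∀ i, ‖T.eval (y i)‖ ≤ 1 / 2) :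
    ‖(Matrix.vandermonde y).det‖ ≤
      M.factorial * (R ^ (T.natDegree * M) * (1 / 2) ^ (∑ k ∈ Finset.range M, k / T.natDegree)) := by
  rw [vand_rowp y T hT]
  refine (det_norm_le _ (fun j => R ^ T.natDegree * (1 / 2) ^ ((j : ℕ) / T.natDegree)) fun i j => ?_).trans ?_
  · simp only [Matrix.of_apply, rowp, eval_mul, eval_pow, eval_X]
    rw [norm_mul, norm_pow, norm_pow]
    gcongr
    · calc ‖y i‖ ^ ((j : ℕ) % T.natDegree) ≤ R ^ ((j : ℕ) % T.natDegree) := by gcongr; exact h1 i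
        _ ≤ _ := pow_le_pow_right₀ hR (Nat.mod_lt _ hN).le
    · exact h2 i
  · rw [Finset.prod_mul_distrib, Finset.prod_const, Finset.prod_pow_eq_pow_sum, Finset.card_univ, Fintype.card_fin,
      ← pow_mul, Finset.sum_range]
end

section

/-- The coefficient ring `ℤ[t₁,…,t_r]`. -/
abbrev AA (r : ℕ) := MvPolynomial (Fin r) ℤ

/-- Generic points. -/
def Gen {r : ℕ} (τ : Fin r → ℂ) : Prop :=
  Function.Injective (MvPolynomial.aeval τ : AA r →ₐ[ℤ] ℂ)

/-- Embeddings over a point. -/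
def Over {r : ℕ} {F : Type} [Field F] [Algebra (AA r) F] (τ : Fin r → ℂ) (ψ : F →+* ℂ) : Prop :=
  ∀ a : AA r, ψ (algebraMap (AA r) F a) = MvPolynomial.aeval τ a

lemma aeval_cont {r : ℕ} (Z : AA r) : Continuous fun τ : Fin r → ℂ => MvPolynomial.aeval τ Z := by
  have : (fun τ : Fin r → ℂ => MvPolynomial.aeval τ Z) = fun τ => MvPolynomial.eval τ (MvPolynomial.map (Int.castRingHom ℂ) Z) := by
    ext τ
    rw [MvPolynomial.eval_map, MvPolynomial.aeval_def]; rfl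
  rw [this]
  exact MvPolynomial.continuous_eval _

lemma gen_dense (r : ℕ) : Dense {τ : Fin r → ℂ | Gen τ} := by
  have hc : Countable (AA r) := 
    (AddMonoidAlgebra.coeff_injective (R := ℤ) (M := Fin r →₀ ℕ)).countable
  have h1 : {τ : Fin r → ℂ | Gen τ} = ⋂ Z : {Z : AA r // Z ≠ 0}, {τ | MvPolynomial.aeval τ Z.1 ≠ 0} := by
    ext τ
    simp only [Gen, Set.mem_ofPred_eq, Set.mem_iInter, Subtype.forall]
    rw [injective_iff_map_eq_zero]
    constructor
    · intro h Z hZ h0; exact hZ (h Z h0)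
    · intro h Z h0; by_contra hZ; exact h Z hZ h0
  rw [h1]
  apply dense_iInter_of_isOpen
  · rintro ⟨Z, hZ⟩
    exact isOpen_ne_fun (aeval_cont Z) continuous_const
  · rintro ⟨Z, hZ⟩
    rw [Metric.dense_iff]
    intro t ρ hρ
    by_contra hne
    rw [Set.not_nonempty_iff_eq_empty] at hne
    apply hZ
    have hinj : Function.Injective (MvPolynomial.map (Int.castRingHom ℂ) : AA r → _) :=
      MvPolynomial.map_injective _ (Int.cast_injective)
    apply hinj
    rw [map_zero]
    apply MvPolynomial.funext_set (fun i => Metric.ball (t i) ρ)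
    · intro i
      exact infinite_of_mem_nhds (t i) (Metric.ball_mem_nhds _ hρ)
    · intro x hx
      have hx' : x ∈ Metric.ball t ρ := by
        rw [Metric.mem_ball, dist_pi_lt_iff hρ]
        intro i
        exact hx i (Set.mem_univ _)
      rw [MvPolynomial.eval_map, map_zero]
      by_contra h0
      have : x ∈ Metric.ball t ρ ∩ {τ | MvPolynomial.aeval τ Z ≠ 0} := ⟨hx', by
        rw [Set.mem_ofPred_eq, MvPolynomial.aeval_def]; exact h0⟩
      rw [hne] at this
      exact this

lemma extend_bound {r : ℕ} (t : Fin r → ℂ) (Z : AA r) (ε s : ℝ) (hε : 0 < ε)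
    (h : ∀ τ, Gen τ → (∀ i, ‖τ i - t i‖ ≤ ε) → ‖MvPolynomial.aeval τ Z‖ ≤ s) :
    ∀ τ, (∀ i, ‖τ i - t i‖ ≤ ε) → ‖MvPolynomial.aeval τ Z‖ ≤ s := by
  have hcl : IsClosed {τ : Fin r → ℂ | ‖MvPolynomial.aeval τ Z‖ ≤ s} :=
    isClosed_le (aeval_cont Z).norm continuous_const
  have h1 : Metric.ball t ε ∩ {τ | Gen τ} ⊆ {τ : Fin r → ℂ | ‖MvPolynomial.aeval τ Z‖ ≤ s} := by
    rintro τ ⟨h1, h2⟩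
    refine h τ h2 fun i => ?_
    rw [Metric.mem_ball, dist_pi_lt_iff hε] at h1
    rw [← dist_eq_norm]
    exact (h1 i).le
  have h2 := closure_minimal h1 hcl
  have h3 : Metric.ball t ε ⊆ closure (Metric.ball t ε ∩ {τ | Gen τ}) :=
    (gen_dense r).open_subset_closure_inter Metric.isOpen_ball
  have h4 := closure_minimal (h3.trans h2) hcl
  rw [closure_ball t hε.ne'] at h4
  intro τ hτ
  apply h4
  rw [Metric.mem_closedBall, dist_pi_le_iff hε.le]
  intro i
  rw [dist_eq_norm]; exact hτ i

section
set_option linter.unusedSectionVars false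
variable {r : ℕ} {F : Type} [Field F] [Algebra (AA r) F] [Algebra (FractionRing (AA r)) F]
  [IsScalarTower (AA r) (FractionRing (AA r)) F] [FiniteDimensional (FractionRing (AA r)) F]

/-- the map K → ℂ -/
noncomputable def liftτ {τ : Fin r → ℂ} (hτ : Gen τ) : FractionRing (AA r) →+* ℂ :=
  IsFractionRing.lift (A := AA r) (g := (MvPolynomial.aeval τ : AA r →ₐ[ℤ] ℂ).toRingHom) hτ

lemma liftτ_alg {τ : Fin r → ℂ} (hτ : Gen τ) (a : AA r) :
    liftτ hτ (algebraMap _ _ a) = MvPolynomial.aeval τ a :=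
  IsFractionRing.lift_algebraMap _ _

lemma over_iff {τ : Fin r → ℂ} (hτ : Gen τ) (ψ : F →+* ℂ) :
    Over τ ψ ↔ ∀ k : FractionRing (AA r), ψ (algebraMap _ F k) = liftτ hτ k := by
  constructor
  · intro h
    have : ψ.comp (algebraMap (FractionRing (AA r)) F) = liftτ hτ := by
      apply IsFractionRing.ringHom_ext (A := AA r)
      intro a
      rw [liftτ_alg, RingHom.comp_apply, ← IsScalarTower.algebraMap_apply]
      exact h a
    intro k; exact congrArg (fun g => g k) this
  · intro h a
    rw [IsScalarTower.algebraMap_apply (AA r) (FractionRing (AA r)) F, h, liftτ_alg]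

lemma L_norm {τ : Fin r → ℂ} (hτ : Gen τ) : ∃ Ψ : Finset (F →+* ℂ),
    Ψ.card = Module.finrank (FractionRing (AA r)) F ∧ (∀ ψ, ψ ∈ Ψ ↔ Over τ ψ) ∧
    ∀ (x : F) (z : AA r), Algebra.norm (FractionRing (AA r)) x = algebraMap _ _ z →
      MvPolynomial.aeval τ z = ∏ ψ ∈ Ψ, ψ x := by
  classical
  let _ : Algebra (FractionRing (AA r)) ℂ := (liftτ hτ).toAlgebra
  have hinj : Function.Injective (fun φ : F →ₐ[FractionRing (AA r)] ℂ => (φ : F →+* ℂ)) :=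
    AlgHom.coe_ringHom_injective
  refine ⟨Finset.univ.image fun φ : F →ₐ[FractionRing (AA r)] ℂ => (φ : F →+* ℂ), ?_, ?_, ?_⟩
  · rw [Finset.card_image_of_injective _ hinj, Finset.card_univ, AlgHom.card]
  · intro ψ
    rw [over_iff hτ]
    simp only [Finset.mem_image, Finset.mem_univ, true_and]
    constructor
    · rintro ⟨φ, rfl⟩ k
      exact φ.commutes k
    · intro h
      exact ⟨{ ψ with commutes' := h }, rfl⟩
  · intro x z h
    rw [Finset.prod_image (fun a _ b _ h => hinj h)]
    have := Algebra.norm_eq_prod_embeddings (FractionRing (AA r)) ℂ x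
    rw [h] at this
    rw [← liftτ_alg hτ]
    exact this
end
end

section

lemma coef_bdd {r : ℕ} (t : Fin r → ℂ) (Z : AA r) :
    ∃ B : ℝ, ∀ τ : Fin r → ℂ, (∀ i, ‖τ i - t i‖ ≤ 2) → ‖MvPolynomial.aeval τ Z‖ ≤ B := by
  obtain ⟨B, hB⟩ := (isCompact_closedBall t 2).exists_bound_of_continuousOn (aeval_cont Z).continuousOn
  refine ⟨B, fun τ hτ => hB τ ?_⟩
  rw [Metric.mem_closedBall, dist_pi_le_iff (by norm_num)]
  intro i
  rw [dist_eq_norm]; exact hτ i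

lemma near_root (P : ℂ[X]) (hP : P.Monic) (z : ℂ) (δ : ℝ) (hδ : 0 < δ)
    (h : ‖P.eval z‖ < δ ^ P.natDegree) : ∃ w, P.IsRoot w ∧ ‖w - z‖ < δ := by
  by_contra hcon
  push Not at hcon
  have hsp : P.Splits := IsAlgClosed.splits P
  have hcard : P.roots.card = P.natDegree := hsp.natDegree_eq_card_roots.symm
  have h1 : P.eval z = (P.roots.map fun w => z - w).prod := by
    conv_lhs => rw [hsp.eq_prod_roots_of_monic hP]
    rw [eval_multiset_prod, Multiset.map_map]
    simp
  have h2 : ∀ s : Multiset ℂ, (∀ w ∈ s, δ ≤ ‖w - z‖) → δ ^ s.card ≤ ‖(s.map fun w => z - w).prod‖ := by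
    intro s
    induction s using Multiset.induction_on with
    | empty => simp
    | cons a s ih =>
      intro hs
      rw [Multiset.card_cons, Multiset.map_cons, Multiset.prod_cons, norm_mul, pow_succ', norm_sub_rev]
      have := ih fun w hw => hs w (Multiset.mem_cons_of_mem hw)
      have h3 := hs a (Multiset.mem_cons_self _ _)
      gcongr
  have h3 := h2 P.roots fun w hw => hcon w (mem_roots'.1 hw).2
  rw [hcard, ← h1] at h3
  linarith

section
set_option linter.unusedSectionVars false
variable {r : ℕ} {F : Type} [Field F] [Algebra (AA r) F] [Algebra (FractionRing (AA r)) F]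
  [IsScalarTower (AA r) (FractionRing (AA r)) F] [FiniteDimensional (FractionRing (AA r)) F]

lemma L_bdd (t : Fin r → ℂ) (x : F) (hx : IsIntegral (AA r) x) :
    ∃ B : ℝ, ∀ τ : Fin r → ℂ, (∀ i, ‖τ i - t i‖ ≤ 2) → ∀ ψ : F →+* ℂ, Over τ ψ → ‖ψ x‖ ≤ B := by
  obtain ⟨p, hp, hpx⟩ := hx
  choose B hB using fun k => coef_bdd t (p.coeff k)
  refine ⟨(∑ k ∈ Finset.range p.natDegree, |B k|) + 1, fun τ hτ ψ hψ => ?_⟩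
  set P : ℂ[X] := p.map (MvPolynomial.aeval τ : AA r →ₐ[ℤ] ℂ).toRingHom with hP
  have hPm : P.Monic := hp.map _
  have hroot : P.IsRoot (ψ x) := by
    rw [IsRoot, hP, eval_map]
    have : (MvPolynomial.aeval τ : AA r →ₐ[ℤ] ℂ).toRingHom = ψ.comp (algebraMap (AA r) F) := by
      apply RingHom.ext
      intro a
      exact (hψ a).symm
    rw [this, ← hom_eval₂, hpx, map_zero]
  have h1 := hroot.norm_lt_cauchyBound hPm.ne_zero
  have h2 : (cauchyBound P : ℝ) ≤ (∑ k ∈ Finset.range p.natDegree, |B k|) + 1 := by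
    rw [cauchyBound, hPm.leadingCoeff]
    simp only [nnnorm_one, div_one, NNReal.coe_add, NNReal.coe_one]
    gcongr
    have : Finset.sup (Finset.range P.natDegree) (fun k => ‖P.coeff k‖₊) ≤
        ⟨∑ k ∈ Finset.range p.natDegree, |B k|, Finset.sum_nonneg fun _ _ => abs_nonneg _⟩ := by
      apply Finset.sup_le
      intro k hk
      rw [hp.natDegree_map] at hk
      have h3 : ‖P.coeff k‖ ≤ ∑ k ∈ Finset.range p.natDegree, |B k| := by
        rw [hP, coeff_map]
        exact ((hB k τ hτ).trans (le_abs_self _)).trans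
          (Finset.single_le_sum (f := fun k => |B k|) (fun _ _ => abs_nonneg _) hk)
      exact h3
    exact_mod_cast this
  have h3 : ‖ψ x‖ < (cauchyBound P : ℝ) := h1
  exact h3.le.trans h2

/-- Evaluate a fraction at a point. -/
noncomputable def phiK (k : FractionRing (AA r)) (τ : Fin r → ℂ) : ℂ :=
  MvPolynomial.aeval τ (IsLocalization.sec (nonZeroDivisors (AA r)) k).1 /
    MvPolynomial.aeval τ ((IsLocalization.sec (nonZeroDivisors (AA r)) k).2 : AA r)

lemma phiK_eq {τ : Fin r → ℂ} (hτ : Gen τ) (k : FractionRing (AA r)) : phiK k τ = liftτ hτ k := by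
  have h := IsLocalization.sec_spec (nonZeroDivisors (AA r)) k
  have h0 : MvPolynomial.aeval τ ((IsLocalization.sec (nonZeroDivisors (AA r)) k).2 : AA r) ≠ 0 := by
    intro h0
    have := hτ (h0.trans (map_zero _).symm)
    exact nonZeroDivisors.ne_zero (IsLocalization.sec (nonZeroDivisors (AA r)) k).2.2 this
  rw [phiK, div_eq_iff h0, ← liftτ_alg hτ, ← liftτ_alg hτ, ← map_mul, h]

lemma phiK_cont {t : Fin r → ℂ} (ht : Gen t) (k : FractionRing (AA r)) : ContinuousAt (phiK k) t := by
  have h0 : MvPolynomial.aeval t ((IsLocalization.sec (nonZeroDivisors (AA r)) k).2 : AA r) ≠ 0 := by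
    intro h0
    have := ht (h0.trans (map_zero _).symm)
    exact nonZeroDivisors.ne_zero (IsLocalization.sec (nonZeroDivisors (AA r)) k).2.2 this
  exact (aeval_cont _).continuousAt.div (aeval_cont _).continuousAt h0

/-- Evaluate a polynomial with fraction coefficients. -/
noncomputable def phiP (q : (FractionRing (AA r))[X]) (p : (Fin r → ℂ) × ℂ) : ℂ :=
  ∑ i ∈ Finset.range (q.natDegree + 1), phiK (q.coeff i) p.1 * p.2 ^ i

lemma phiP_cont {t : Fin r → ℂ} (ht : Gen t) (q : (FractionRing (AA r))[X]) (w : ℂ) :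
    ContinuousAt (phiP q) (t, w) := by
  apply tendsto_finsetSum
  intro i _
  apply ContinuousAt.mul
  · exact ContinuousAt.comp (f := Prod.fst) (x := (t, w)) (phiK_cont ht _) continuousAt_fst
  · exact continuousAt_snd.pow _

lemma phiP_eq {τ : Fin r → ℂ} (hτ : Gen τ) (q : (FractionRing (AA r))[X]) (w : ℂ) :
    phiP q (τ, w) = (q.map (liftτ hτ)).eval w := by
  rw [eval_map, eval₂_eq_sum_range]
  exact Finset.sum_congr rfl fun i _ => by rw [phiK_eq hτ]

lemma phiP_over {τ : Fin r → ℂ} (hτ : Gen τ) (ψ : F →+* ℂ) (hψ : Over τ ψ) (q : (FractionRing (AA r))[X]) (θ : F) :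
    ψ (aeval θ q) = phiP q (τ, ψ θ) := by
  rw [phiP_eq hτ, eval_map, aeval_def, hom_eval₂]
  congr 1
  ext k
  exact (over_iff hτ ψ).1 hψ k

lemma L_near {t : Fin r → ℂ} (ht : Gen t) (ι : F →+* ℂ) (hι : Over t ι) (s : Finset F) (ε : ℝ) (hε : 0 < ε) :
    ∃ ρ : ℝ, 0 < ρ ∧ ∀ τ : Fin r → ℂ, Gen τ → (∀ i, ‖τ i - t i‖ ≤ ρ) →
      ∃ ψ : F →+* ℂ, Over τ ψ ∧ ∀ a ∈ s, ‖ψ a - ι a‖ < ε := by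
  obtain ⟨θ, hθ⟩ := Field.exists_primitive_element (FractionRing (AA r)) F
  have hInteg : IsIntegral (FractionRing (AA r)) θ := IsIntegral.of_finite _ _
  have hq : ∀ a : F, ∃ q : (FractionRing (AA r))[X], aeval θ q = a := by
    intro a
    have h : a ∈ (⊤ : IntermediateField (FractionRing (AA r)) F).toSubalgebra := trivial
    rw [← hθ, IntermediateField.adjoin_simple_toSubalgebra_of_isAlgebraic hInteg.isAlgebraic,
      Algebra.adjoin_singleton_eq_range_aeval] at h
    exact h
  choose q hq using hq
  have h1 : ∀ᶠ p in nhds (t, ι θ), ∀ a ∈ s, ‖phiP (q a) p - ι a‖ < ε := by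
    rw [Finset.eventually_all]
    intro a _
    have h := phiP_cont ht (q a) (ι θ)
    have h2 : phiP (q a) (t, ι θ) = ι a := by rw [← phiP_over ht ι hι, hq]
    have := Metric.tendsto_nhds.1 h ε hε
    rw [h2] at this
    simpa [dist_eq_norm] using this
  obtain ⟨δ, hδ, h1⟩ := Metric.eventually_nhds_iff.1 h1
  set P := minpoly (FractionRing (AA r)) θ with hP
  have hPm : P.Monic := minpoly.monic hInteg
  have h2 : ContinuousAt (fun τ => phiP P (τ, ι θ)) t :=
    ContinuousAt.comp (f := fun τ => (τ, ι θ)) (phiP_cont ht P (ι θ)) (by fun_prop)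
  have h3 : phiP P (t, ι θ) = 0 := by rw [← phiP_over ht ι hι, hP, minpoly.aeval, map_zero]
  have h4 := Metric.tendsto_nhds.1 h2 (δ ^ P.natDegree) (by positivity)
  obtain ⟨ρ, hρ, h4⟩ := Metric.eventually_nhds_iff.1 h4
  refine ⟨min ρ δ / 2, by positivity, fun τ hτ hd => ?_⟩
  have hd' : dist τ t < min ρ δ := by
    rw [dist_pi_lt_iff (by positivity)]
    intro i
    rw [dist_eq_norm]
    have := hd i
    have : 0 < min ρ δ := by positivity
    linarith
  have h5 := h4 (hd'.trans_le (min_le_left _ _))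
  simp only [] at h5
  rw [h3, dist_eq_norm, sub_zero, phiP_eq hτ] at h5
  have hdeg : (P.map (liftτ hτ)).natDegree = P.natDegree := natDegree_map _
  rw [← hdeg] at h5
  obtain ⟨w, hw, hwd⟩ := near_root _ (hPm.map _) _ _ hδ h5
  let _ : Algebra (FractionRing (AA r)) ℂ := (liftτ hτ).toAlgebra
  have hw2 : w ∈ (minpoly (FractionRing (AA r)) θ).rootSet ℂ := by
    rw [mem_rootSet]
    refine ⟨minpoly.ne_zero hInteg, ?_⟩
    rw [aeval_def, ← eval_map]
    exact hw
  rw [← Algebra.IsAlgebraic.range_eval_eq_rootSet_minpoly ℂ θ] at hw2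
  obtain ⟨φ, hφ⟩ := hw2
  have hover : Over τ (φ : F →+* ℂ) := by
    rw [over_iff hτ]
    intro k; exact φ.commutes k
  refine ⟨φ, hover, fun a ha => ?_⟩
  have h6 := phiP_over hτ (φ : F →+* ℂ) hover (q a) θ
  rw [hq] at h6
  rw [h6]
  apply h1 _ a ha
  have hφ' : (φ : F →+* ℂ) θ = w := hφ
  rw [hφ', Prod.dist_eq, max_lt_iff]
  exact ⟨hd'.trans_le (min_le_right _ _), by rw [dist_eq_norm]; exact hwd⟩
end
end

section

lemma exists_max_indep (s : Finset ℂ) : ∃ T : Finset ℂ, AlgebraicIndepOn ℤ id (T : Set ℂ) ∧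
    ∀ x ∈ s, IsAlgebraic (Algebra.adjoin ℤ (T : Set ℂ)) x := by
  classical
  obtain ⟨T, hT, hmax⟩ := Finset.exists_max_image
    (s.powerset.filter fun T : Finset ℂ => AlgebraicIndepOn ℤ id (T : Set ℂ)) Finset.card
    ⟨∅, by
      simp only [Finset.mem_filter, Finset.mem_powerset, Finset.empty_subset, true_and, Finset.coe_empty]
      exact (algebraicIndependent_empty_iff ..).mpr (algebraMap ℤ ℂ).injective_int⟩
  rw [Finset.mem_filter, Finset.mem_powerset] at hT
  refine ⟨T, hT.2, fun x hx => ?_⟩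
  by_contra hna
  have hxT : x ∉ T := fun h => hna (isAlgebraic_algebraMap (⟨x, Algebra.subset_adjoin h⟩ : Algebra.adjoin ℤ (T : Set ℂ)))
  have h1 : AlgebraicIndepOn ℤ id (insert x (T : Set ℂ)) := by
    apply AlgebraicIndepOn.insert hT.2
    rw [Set.image_id]; exact hna
  have := hmax (insert x T) (by
    rw [Finset.mem_filter, Finset.mem_powerset, Finset.coe_insert]
    exact ⟨Finset.insert_subset hx hT.1, h1⟩)
  rw [Finset.card_insert_of_notMem hxT] at this
  omega

theorem field_setup (s : Finset ℂ) : ∃ (r : ℕ) (t : Fin r → ℂ) (F : Type) (_ : Field F)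
    (_ : Algebra (AA r) F) (_ : Algebra (FractionRing (AA r)) F)
    (_ : IsScalarTower (AA r) (FractionRing (AA r)) F)
    (_ : FiniteDimensional (FractionRing (AA r)) F) (ι : F →+* ℂ),
    Gen t ∧ Over t ι ∧ ∀ x ∈ s, ∃ a, ι a = x := by
  obtain ⟨T, hT, hs⟩ := exists_max_indep s
  let t : Fin T.card → ℂ := fun i => (T.equivFin.symm i : ℂ)
  have ht' : AlgebraicIndependent ℤ t := AlgebraicIndependent.comp hT _ T.equivFin.symm.injective
  have ht : Gen t := ht'
  have hrange : Set.range t = (T : Set ℂ) := by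
    ext x
    constructor
    · rintro ⟨i, rfl⟩; exact (T.equivFin.symm i).2
    · intro hx; exact ⟨T.equivFin ⟨x, hx⟩, by simp [t]⟩
  rw [← hrange] at hs
  let _ : Algebra (FractionRing (AA T.card)) ℂ := (liftτ ht).toAlgebra
  have halg : ∀ x ∈ s, IsIntegral (FractionRing (AA T.card)) x := by
    intro x hx
    rw [← isAlgebraic_iff_isIntegral]
    obtain ⟨p, hp0, hp⟩ := hs x hx
    let e : Algebra.adjoin ℤ (Set.range t) →+* FractionRing (AA T.card) :=
      (algebraMap (AA T.card) _).comp (ht'.aevalEquiv.symm : Algebra.adjoin ℤ (Set.range t) ≃ₐ[ℤ] _).toRingEquiv.toRingHom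
    have he : Function.Injective e :=
      (IsFractionRing.injective (AA T.card) (FractionRing (AA T.card))).comp ht'.aevalEquiv.symm.injective
    refine ⟨p.map e, ?_, ?_⟩
    · exact (Polynomial.map_ne_zero_iff he).2 hp0
    · rw [aeval_def, eval₂_map]
      have : (algebraMap (FractionRing (AA T.card)) ℂ).comp e = algebraMap (Algebra.adjoin ℤ (Set.range t)) ℂ := by
        apply RingHom.ext
        intro a
        have h1 : (algebraMap (FractionRing (AA T.card)) ℂ).comp e a =
          liftτ ht (algebraMap _ _ (ht'.aevalEquiv.symm a)) := rfl
        rw [h1, liftτ_alg]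
        have h2 := ht'.algebraMap_aevalEquiv (ht'.aevalEquiv.symm a)
        rw [AlgEquiv.apply_symm_apply] at h2
        exact h2.symm
      rw [this]
      exact hp
  let F := IntermediateField.adjoin (FractionRing (AA T.card)) (s : Set ℂ)
  have hfin : FiniteDimensional (FractionRing (AA T.card)) F :=
    IntermediateField.finiteDimensional_adjoin fun x hx => halg x hx
  let algF : Algebra (AA T.card) F := ((algebraMap (FractionRing (AA T.card)) F).comp (algebraMap (AA T.card) (FractionRing (AA T.card)))).toAlgebra
  refine ⟨T.card, t, F, inferInstance, algF, inferInstance, ?_, hfin, algebraMap F ℂ, ht, ?_, ?_⟩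
  · exact IsScalarTower.of_algebraMap_eq' rfl
  · intro a
    exact liftτ_alg ht a
  · intro x hx
    exact ⟨⟨x, IntermediateField.subset_adjoin _ _ hx⟩, rfl⟩
end

section

section
variable {A : Type*} [CommRing A] [Algebra A ℂ]

lemma lift_int (q : ℂ[X]) (h : ∀ i, IsIntegral A (q.coeff i)) :
    ∃ Q : (integralClosure A ℂ)[X], Q.map (algebraMap (integralClosure A ℂ) ℂ) = q := by
  have : q ∈ lifts (algebraMap (integralClosure A ℂ) ℂ) := by
    rw [lifts_iff_coeff_lifts]
    intro i
    exact ⟨⟨q.coeff i, h i⟩, rfl⟩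
  exact this

lemma int_root (Q : (integralClosure A ℂ)[X]) (hQ : Q.Monic) (z : ℂ) (h : aeval z Q = 0) : IsIntegral A z :=
  isIntegral_trans (A := integralClosure A ℂ) z ⟨Q, hQ, h⟩

lemma int_root' (Q : (integralClosure A ℂ)[X]) (hQ : Q.Monic) (hd : 0 < Q.natDegree) (z : ℂ)
    (h : IsIntegral A (aeval z Q)) : IsIntegral A z := by
  have hdeg : (C (⟨aeval z Q, h⟩ : integralClosure A ℂ)).degree < Q.degree :=
    degree_C_le.trans_lt (natDegree_pos_iff_degree_pos.1 hd)
  refine int_root (Q - C (⟨aeval z Q, h⟩ : integralClosure A ℂ)) (hQ.sub_of_left hdeg) z ?_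
  rw [map_sub, aeval_C]
  exact sub_self _

lemma lift_scale (f : ℂ[X]) (hf : f.Monic) (L : ℂ) (hL : IsIntegral A L) (h : ∀ i, IsIntegral A (L * f.coeff i))
    (u : ℕ) (hu : 1 ≤ u) : ∃ G : (integralClosure A ℂ)[X], G.Monic ∧ G.natDegree = f.natDegree ∧
      ∀ w, aeval (L ^ u * w) G = L ^ (u * f.natDegree) * f.eval w := by
  obtain ⟨G, hG⟩ := lift_int (A := A) (f.scaleRoots (L ^ u)) (by
    intro i
    rw [coeff_scaleRoots]
    rcases lt_trichotomy i f.natDegree with hi | hi | hi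
    · obtain ⟨q, hq⟩ : ∃ q, u * (f.natDegree - i) = q + 1 := 
        Nat.exists_eq_add_one_of_ne_zero (Nat.mul_ne_zero (by omega) (by omega))
      rw [← pow_mul, hq]
      have := (h i).mul (hL.pow q)
      rw [pow_succ', ← mul_assoc, mul_comm (f.coeff i)]
      exact this
    · rw [hi, coeff_natDegree, hf.leadingCoeff]
      simpa using isIntegral_one
    · rw [coeff_eq_zero_of_natDegree_lt hi, zero_mul]; exact isIntegral_zero)
  have hinj : Function.Injective (algebraMap (integralClosure A ℂ) ℂ) := Subtype.val_injective
  refine ⟨G, ?_, ?_, ?_⟩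
  · apply hinj.monic_map_iff.2
    rw [hG]; exact (monic_scaleRoots_iff _).2 hf
  · rw [← natDegree_map_eq_of_injective hinj, hG, natDegree_scaleRoots]
  · intro w
    rw [aeval_def, ← eval_map, hG, scaleRoots_eval_mul, pow_mul]

lemma lift_iter (f : ℂ[X]) (hf : f.Monic) (hd : 0 < f.natDegree) (L : ℂ) (hL : IsIntegral A L) (h : ∀ i, IsIntegral A (L * f.coeff i))
    (n : ℕ) : ∃ P : (integralClosure A ℂ)[X], P.Monic ∧ P.natDegree = f.natDegree ^ n ∧
      ∀ z, aeval (L * z) P = L ^ (f.natDegree ^ n) * (fun y => f.eval y)^[n] z := by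
  induction n with
  | zero => exact ⟨X, monic_X, by simp, by simp⟩
  | succ n ih =>
    obtain ⟨P, hP, hPd, hPe⟩ := ih
    obtain ⟨G, hG, hGd, hGe⟩ := lift_scale f hf L hL h (f.natDegree ^ n) (Nat.one_le_pow _ _ hd)
    refine ⟨G.comp P, hG.comp hP ?_, ?_, ?_⟩
    · rw [hPd]; positivity
    · rw [natDegree_comp, hGd, hPd, pow_succ']
    · intro z
      rw [aeval_comp, hPe, hGe, Function.iterate_succ_apply', pow_succ]

lemma integ (f c : ℂ[X]) (hf : f.Monic) (hd : 2 ≤ f.natDegree) (e : ℕ) (hc : c.natDegree ≤ e)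
    (L : ℂ) (hL : IsIntegral A L) (h : ∀ i, IsIntegral A (L * f.coeff i)) (h' : ∀ i, IsIntegral A (L * c.coeff i))
    (n : ℕ) (hn : e + 1 ≤ n) (y : ℂ) (hy : (fun y => f.eval y)^[n] y = c.eval y) (k : ℕ) (hk : k + e ≤ n) :
    IsIntegral A (L * (fun y => f.eval y)^[k] y) := by
  obtain ⟨Cc, hCc⟩ := lift_int (A := A) (∑ i ∈ Finset.range (e + 1), C (c.coeff i * L ^ (e + 1 - i)) * X ^ i) (by
    intro i
    rw [finsetSum_coeff]
    refine IsIntegral.sum _ fun j hj => ?_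
    rw [coeff_C_mul_X_pow]
    split_ifs
    · obtain ⟨q, hq⟩ : ∃ q, e + 1 - j = q + 1 := ⟨e - j, by rw [Finset.mem_range] at hj; omega⟩
      rw [hq]
      have := (h' j).mul (hL.pow q)
      convert this using 1
      ring
    · exact isIntegral_zero)
  have hinj : Function.Injective (algebraMap (integralClosure A ℂ) ℂ) := Subtype.val_injective
  have hCd : Cc.natDegree ≤ e := by
    rw [← natDegree_map_eq_of_injective hinj, hCc]
    refine natDegree_sum_le_of_forall_le _ _ fun i hi => ?_
    refine (natDegree_C_mul_X_pow_le _ _).trans ?_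
    rw [Finset.mem_range] at hi; omega
  have hCe : ∀ z, aeval (L * z) Cc = L ^ (e + 1) * c.eval z := by
    intro z
    rw [aeval_def, ← eval_map, hCc, eval_finsetSum, eval_eq_sum_range' (Nat.lt_succ_of_le hc), Finset.mul_sum]
    refine Finset.sum_congr rfl fun i hi => ?_
    rw [Finset.mem_range] at hi
    obtain ⟨q, hq⟩ := Nat.exists_eq_add_of_le hi.le
    rw [show e + 1 = i + q from hq, Nat.add_sub_cancel_left]
    simp only [eval_mul, eval_C, eval_pow, eval_X]
    ring
  obtain ⟨P, hP, hPd, hPe⟩ := lift_iter f hf (by omega) L hL h n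
  have hlt : n < f.natDegree ^ n := Nat.lt_pow_self (by omega)
  -- `L * y` is integral
  have hy0 : IsIntegral A (L * y) := by
    have hdeg : (C ((⟨L, hL⟩ : integralClosure A ℂ) ^ (f.natDegree ^ n - (e + 1))) * Cc).degree < P.degree := by
      apply degree_lt_degree
      refine (natDegree_C_mul_le _ _).trans_lt ?_
      rw [hPd]; omega
    refine int_root (P - C ((⟨L, hL⟩ : integralClosure A ℂ) ^ (f.natDegree ^ n - (e + 1))) * Cc)
      (hP.sub_of_left hdeg) _ ?_
    rw [map_sub, map_mul, hPe, hCe, aeval_C, map_pow, hy]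
    change L ^ _ * _ - L ^ _ * _ = 0
    rw [← mul_assoc, ← pow_add, Nat.sub_add_cancel (by omega), sub_self]
  have hcy : IsIntegral A (L ^ (e + 1) * (fun y => f.eval y)^[n] y) := by
    rw [hy, ← hCe]
    have h1 : IsIntegral (integralClosure A ℂ) (aeval (L * y) Cc) := by
      rw [aeval_eq_sum_range]
      refine IsIntegral.sum _ fun i _ => IsIntegral.smul _ ((hy0.tower_top).pow _)
    exact isIntegral_trans _ h1
  -- descend
  have hstep : ∀ j, j ≤ e → IsIntegral A (L ^ (e + 1 - j) * (fun y => f.eval y)^[n - j] y) := by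
    intro j
    induction j with
    | zero => intro _; exact hcy
    | succ j ih =>
      intro hj
      have ih := ih (by omega)
      obtain ⟨G, hG, hGd, hGe⟩ := lift_scale f hf L hL h (e + 1 - (j + 1)) (by omega)
      refine int_root' G hG (by omega) _ ?_
      rw [hGe]
      have h1 : f.eval ((fun y => f.eval y)^[n - (j + 1)] y) = (fun y => f.eval y)^[n - j] y := by
        rw [show n - j = (n - (j + 1)) + 1 by omega, Function.iterate_succ_apply']
      rw [h1]
      have h2 : e + 1 - j ≤ (e + 1 - (j + 1)) * f.natDegree := by
        calc e + 1 - j ≤ (e + 1 - (j + 1)) * 2 := by omega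
          _ ≤ _ := Nat.mul_le_mul_left _ hd
      obtain ⟨q, hq⟩ := Nat.exists_eq_add_of_le h2
      rw [hq, pow_add, mul_assoc, mul_left_comm]
      exact (hL.pow _).mul ih
  have hstep2 : ∀ j, e ≤ j → j ≤ n → IsIntegral A (L * (fun y => f.eval y)^[n - j] y) := by
    intro j hj
    induction j, hj using Nat.le_induction with
    | base =>
      intro _
      have := hstep e le_rfl
      simpa using this
    | succ j hj ih =>
      intro hjn
      have ih := ih (by omega)
      obtain ⟨G, hG, hGd, hGe⟩ := lift_scale f hf L hL h 1 le_rfl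
      refine int_root' G hG (by omega) _ ?_
      rw [pow_one] at hGe
      rw [hGe]
      have h1 : f.eval ((fun y => f.eval y)^[n - (j + 1)] y) = (fun y => f.eval y)^[n - j] y := by
        rw [show n - j = (n - (j + 1)) + 1 by omega, Function.iterate_succ_apply']
      rw [h1]
      obtain ⟨q, hq⟩ := Nat.exists_eq_add_of_le (show 1 ≤ 1 * f.natDegree by omega)
      rw [hq, pow_add, pow_one, mul_assoc, mul_left_comm]
      exact (hL.pow _).mul ih
  have := hstep2 (n - k) (by omega) (by omega)
  rwa [Nat.sub_sub_self (by omega)] at this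
end
end

section

lemma sum_div_lower (D M : ℕ) (hD : 1 ≤ D) :
    (M : ℝ) * (M - 1) / (2 * D) - M ≤ ((∑ k ∈ Finset.range M, k / D : ℕ) : ℝ) := by
  have hD' : (1 : ℝ) ≤ D := by exact_mod_cast hD
  induction M with
  | zero => simp
  | succ M ih =>
    rw [Finset.sum_range_succ]
    push_cast
    have h1 : (M : ℝ) / D - 1 ≤ ((M / D : ℕ) : ℝ) := by
      have h : M < D * (M / D + 1) := by
        have := Nat.lt_mul_div_succ M (show 0 < D by omega)
        simpa using this
      have h' : (M : ℝ) < D * ((M / D : ℕ) + 1) := by exact_mod_cast h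
      rw [sub_le_iff_le_add, div_le_iff₀ (by linarith)]
      nlinarith
    push_cast at ih
    have h2 : ((M : ℝ) + 1) * (M + 1 - 1) / (2 * D) = M * (M - 1) / (2 * D) + M / D := by
      field_simp; ring
    rw [h2]
    linarith

set_option maxHeartbeats 1000000 in
lemma num_lemma (d H D : ℕ) (B R : ℝ) (hd : 2 ≤ d) (hD : 1 ≤ D) (hB : 1 ≤ B) (hR : 1 ≤ R) :
    ∃ m0 M0 : ℕ, ∀ M, M0 ≤ M →
      ((M.factorial : ℝ) ^ 2 * B ^ (2 * (M * (d ^ m0 + M / d ^ m0)))) ^ H *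
        (R ^ (D * M) * (1 / 2) ^ (∑ k ∈ Finset.range M, k / D)) ^ 2 < 1 := by
  have hl2 : 0 < Real.log 2 := Real.log_pos (by norm_num)
  have hlB : 0 ≤ Real.log B := Real.log_nonneg hB
  have hlR : 0 ≤ Real.log R := Real.log_nonneg hR
  have hD' : (1 : ℝ) ≤ D := by exact_mod_cast hD
  set q : ℝ := Real.log 2 / (8 * D) with hq
  have hq0 : 0 < q := by positivity
  obtain ⟨m0, hm0⟩ := exists_nat_ge (H * Real.log B / q)
  set N := d ^ m0 with hN
  have hN0 : m0 < N := Nat.lt_pow_self (by omega)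
  have hNr : H * Real.log B ≤ q * N := by
    have : (m0 : ℝ) ≤ N := by exact_mod_cast hN0.le
    have h := hm0.trans this
    rw [div_le_iff₀ hq0] at h
    linarith
  have hNpos : (0 : ℝ) < N := by
    have : 0 < N := by omega
    exact_mod_cast this
  -- log M = o(M)
  have hlog : ∀ᶠ M : ℕ in Filter.atTop, H * Real.log M ≤ q * M := by
    have h := (Real.isLittleO_log_id_atTop.def (show 0 < q / (H + 1) by positivity))
    have h2 := tendsto_natCast_atTop_atTop (R := ℝ).eventually h
    filter_upwards [h2] with M hM
    simp only [id, Real.norm_eq_abs, Nat.abs_cast] at hM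
    have h3 := (le_abs_self _).trans hM
    have h4 : (H + 1 : ℝ) * Real.log M ≤ q * M := by
      calc (H + 1 : ℝ) * Real.log M ≤ (H + 1) * (q / (H + 1) * M) := by gcongr
        _ = q * M := by field_simp
    have h5 : 0 ≤ Real.log M := Real.log_natCast_nonneg M
    nlinarith
  set cst : ℝ := H * N * Real.log B + D * Real.log R + 2 * Real.log 2 with hcst
  have hc : ∀ᶠ M : ℕ in Filter.atTop, cst ≤ q * M := by
    obtain ⟨K, hK⟩ := exists_nat_ge (cst / q)
    filter_upwards [Filter.eventually_ge_atTop K] with M hM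
    have : (K : ℝ) ≤ M := by exact_mod_cast hM
    have h := hK.trans this
    rw [div_le_iff₀ hq0] at h
    linarith
  obtain ⟨M0, hM0⟩ := Filter.eventually_atTop.1 ((hlog.and hc).and (Filter.eventually_ge_atTop 1))
  refine ⟨m0, M0, fun M hM => ?_⟩
  obtain ⟨⟨h1, h2⟩, h3⟩ := hM0 M hM
  have hMr : (1 : ℝ) ≤ M := by exact_mod_cast h3
  rw [← hN]
  set Sg := ∑ k ∈ Finset.range M, k / D with hSg
  have hS := sum_div_lower D M hD
  rw [← hSg] at hS
  have hfac : (0 : ℝ) < M.factorial := by exact_mod_cast M.factorial_pos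
  have hpos : 0 < ((M.factorial : ℝ) ^ 2 * B ^ (2 * (M * (N + M / N)))) ^ H *
        (R ^ (D * M) * (1 / 2) ^ Sg) ^ 2 := by positivity
  rw [← Real.log_neg_iff hpos]
  have hlogeq : Real.log (((M.factorial : ℝ) ^ 2 * B ^ (2 * (M * (N + M / N)))) ^ H *
        (R ^ (D * M) * (1 / 2) ^ Sg) ^ 2) =
      H * (2 * Real.log M.factorial + 2 * (M * (N + (M / N : ℕ))) * Real.log B) +
        2 * (D * M * Real.log R - Sg * Real.log 2) := by
    rw [Real.log_mul (by positivity) (by positivity), Real.log_pow, Real.log_pow,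
      Real.log_mul (by positivity) (by positivity), Real.log_mul (by positivity) (by positivity),
      Real.log_pow, Real.log_pow, Real.log_pow, Real.log_pow, one_div, Real.log_inv]
    push_cast
    ring
  rw [hlogeq]
  have hfl : Real.log M.factorial ≤ M * Real.log M := by
    rw [← Real.log_pow]
    apply Real.log_le_log hfac
    exact_mod_cast Nat.factorial_le_pow M
  have hdiv : ((M / N : ℕ) : ℝ) ≤ M / N := Nat.cast_div_le
  have e1 : (H : ℝ) * (2 * Real.log M.factorial) ≤ 2 * M * (q * M) := by
    calc (H : ℝ) * (2 * Real.log M.factorial) ≤ H * (2 * (M * Real.log M)) := by gcongr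
      _ = 2 * M * (H * Real.log M) := by ring
      _ ≤ _ := by gcongr
  have e2 : (H : ℝ) * (2 * (M * (N + (M / N : ℕ))) * Real.log B) ≤ 2 * M * (H * N * Real.log B + q * M) := by
    calc (H : ℝ) * (2 * (M * (N + (M / N : ℕ))) * Real.log B)
        ≤ (H : ℝ) * (2 * (M * (N + M / N)) * Real.log B) := by gcongr
      _ = 2 * M * (H * N * Real.log B + (H * Real.log B) * (M / N)) := by ring
      _ ≤ 2 * M * (H * N * Real.log B + (q * N) * (M / N)) := by gcongr
      _ = _ := by field_simp
  have e3 : 2 * (D * M * Real.log R - Sg * Real.log 2) ≤ 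
      2 * M * (D * Real.log R + 2 * Real.log 2 - 4 * q * M) := by
    have h4 : (M * (M - 1) / (2 * D) - M) * Real.log 2 ≤ Sg * Real.log 2 := by gcongr
    have h5 : (M : ℝ) * (M - 1) / (2 * D) * Real.log 2 = M * (4 * q * (M - 1)) := by
      rw [hq]; field_simp; ring
    have h6 : 4 * q ≤ Real.log 2 := by
      rw [hq, mul_div_assoc', div_le_iff₀ (by positivity)]
      nlinarith
    rw [sub_mul, h5] at h4
    have h7 : (M : ℝ) * (4 * q) ≤ M * Real.log 2 := by gcongr
    linarith
  have e4 : 2 * M * (q * M) + 2 * M * (H * N * Real.log B + q * M) +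
      2 * M * (D * Real.log R + 2 * Real.log 2 - 4 * q * M) = 2 * M * (cst - 2 * (q * M)) := by
    rw [hcst]; ring
  have e5 : 2 * M * (cst - 2 * (q * M)) < 0 := by
    have : 0 < q * M := by positivity
    nlinarith
  rw [mul_add]
  linarith
end

section

lemma exists_Q {F : Type} [Field F] (ι : F →+* ℂ) (fF gF cF : F[X]) (hd : 2 ≤ fF.natDegree)
    (m : ℕ) (hm : cF.natDegree + 1 ≤ m)
    (hinf : {x : ℂ | ∃ n, m ≤ n ∧ (fun y => (fF.map ι).eval y)^[n] x = (cF.map ι).eval x ∧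
      (fun y => (gF.map ι).eval y)^[n] x = (cF.map ι).eval x}.Infinite) (M0 : ℕ) :
    ∃ Q : F[X], Q.Monic ∧ Q.Separable ∧ M0 ≤ Q.natDegree ∧
      ∀ (ψ : F →+* ℂ) (y : ℂ), (Q.map ψ).IsRoot y →
        ∃ n, m ≤ n ∧ (fun y => (fF.map ψ).eval y)^[n] y = (cF.map ψ).eval y ∧
          (fun y => (gF.map ψ).eval y)^[n] y = (cF.map ψ).eval y := by
  classical
  have : CharZero F := ⟨fun a b h => by have := congrArg ι h; simpa using this⟩
  let _ : Algebra F ℂ := ι.toAlgebra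
  obtain ⟨s, hsX, hscard⟩ := hinf.exists_subset_card_eq M0
  have hInteg : ∀ x ∈ s, IsIntegral F x := by
    intro x hx
    obtain ⟨n, hn, h1, h2⟩ := hsX hx
    rw [← isAlgebraic_iff_isIntegral]
    refine ⟨itr fF n - cF, ?_, ?_⟩
    · intro h0
      have h3 : itr fF n = cF := sub_eq_zero.1 h0
      have h4 := itr_natDegree fF n
      rw [h3] at h4
      have : n < fF.natDegree ^ n := Nat.lt_pow_self (by omega)
      omega
    · rw [aeval_def, ← eval_map, Polynomial.map_sub, eval_sub, sub_eq_zero]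
      rw [itr_map, itr_eval]
      exact h1
  have hmem : ∀ q ∈ s.image (minpoly F), ∃ x ∈ s, minpoly F x = q := fun q hq => Finset.mem_image.1 hq
  have hmon : ∀ q ∈ s.image (minpoly F), q.Monic := by
    intro q hq
    obtain ⟨x, hx, rfl⟩ := hmem q hq
    exact minpoly.monic (hInteg x hx)
  have hirr : ∀ q ∈ s.image (minpoly F), Irreducible q := by
    intro q hq
    obtain ⟨x, hx, rfl⟩ := hmem q hq
    exact minpoly.irreducible (hInteg x hx)
  have hQm : (∏ q ∈ s.image (minpoly F), q).Monic := monic_prod_of_monic _ _ hmon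
  refine ⟨∏ q ∈ s.image (minpoly F), q, hQm, ?_, ?_, ?_⟩
  · apply separable_prod'
    · intro p hp q hq hpq
      rcases (EuclideanDomain.dvd_or_coprime p q (hirr p hp)).symm with h | h
      · exact h
      · exfalso
        apply hpq
        have := (hirr p hp).associated_of_dvd (hirr q hq) h
        exact eq_of_monic_of_associated (hmon p hp) (hmon q hq) this
    · intro q hq
      exact (hirr q hq).separable
  · rw [← hscard]
    have h1 : s ⊆ ((∏ q ∈ s.image (minpoly F), q).map ι).roots.toFinset := by
      intro x hx
      rw [Multiset.mem_toFinset, mem_roots (hQm.map ι).ne_zero, IsRoot, Polynomial.map_prod, eval_prod]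
      apply Finset.prod_eq_zero (Finset.mem_image_of_mem _ hx)
      rw [eval_map]
      exact minpoly.aeval F x
    refine (Finset.card_le_card h1).trans ((Multiset.toFinset_card_le _).trans ?_)
    refine (card_roots' _).trans ?_
    rw [natDegree_map]
  · intro ψ y hy
    rw [IsRoot, Polynomial.map_prod, eval_prod, Finset.prod_eq_zero_iff] at hy
    obtain ⟨q, hq, hqy⟩ := hy
    obtain ⟨x, hx, rfl⟩ := hmem q hq
    obtain ⟨n, hn, h1, h2⟩ := hsX hx
    have key : ∀ p : F[X], (fun y => (p.map ι).eval y)^[n] x = (cF.map ι).eval x →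
        (fun y => (p.map ψ).eval y)^[n] y = (cF.map ψ).eval y := by
      intro p hp
      have hdvd : minpoly F x ∣ itr p n - cF := by
        apply minpoly.dvd
        rw [aeval_def, ← eval_map, Polynomial.map_sub, eval_sub, sub_eq_zero, itr_map, itr_eval]
        exact hp
      obtain ⟨u, hu⟩ := hdvd
      have h3 := congrArg (fun w => (w.map ψ).eval y) hu
      simp only [Polynomial.map_sub, eval_sub, Polynomial.map_mul, eval_mul, hqy, zero_mul] at h3
      rw [itr_map, itr_eval] at h3
      exact sub_eq_zero.1 h3
    exact ⟨n, hn, key fF h1, key gF h2⟩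
end

section

lemma disc_exists' (P : ℂ[X]) (hP : P.Monic) (M n : ℕ) (hM : P.natDegree = M) (hn : P.derivative.natDegree ≤ n) :
    ∃ y : Fin M → ℂ, (∀ i, P.IsRoot (y i)) ∧ ∃ s : ℂ, (s = 1 ∨ s = -1) ∧
      resultant P P.derivative M n = s * (Matrix.vandermonde y).det ^ 2 := by
  subst hM
  exact disc_exists P hP n hn

/-- iterate of the specialised polynomial -/
noncomputable def ev {F : Type} [Field F] (ψ : F →+* ℂ) (p : F[X]) (n : ℕ) (y : ℂ) : ℂ :=
  (fun y => (p.map ψ).eval y)^[n] y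

lemma ev_eq {F : Type} [Field F] (ψ : F →+* ℂ) (p : F[X]) (n : ℕ) (y : ℂ) :
    ev ψ p n y = ((itr p n).map ψ).eval y := by
  rw [itr_map, itr_eval]; rfl

lemma core {r : ℕ} {F : Type} [Field F] [Algebra (AA r) F] [Algebra (FractionRing (AA r)) F]
    [IsScalarTower (AA r) (FractionRing (AA r)) F] [FiniteDimensional (FractionRing (AA r)) F]
    [Algebra (AA r) ℂ] {t : Fin r → ℂ} (ht : Gen t)
    (halg : ∀ a : AA r, algebraMap (AA r) ℂ a = MvPolynomial.aeval t a)
    (ι : F →+* ℂ) (hι : Over t ι) (fF gF cF : F[X]) (hfm : fF.Monic) (hd : 2 ≤ fF.natDegree)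
    (L : AA r) (hL : L ≠ 0) (B R ρ : ℝ) (hB : 1 ≤ B) (hR : 1 ≤ R) (hρ : 0 < ρ) (m e : ℕ)
    (he : cF.natDegree ≤ e)
    (hInteg : ∀ n k y, e + 1 ≤ n → k + e ≤ n → ev ι fF n y = (cF.map ι).eval y →
      IsIntegral (AA r) (algebraMap (AA r) ℂ L * ev ι fF k y))
    (hbd : ∀ τ, Gen τ → (∀ i, ‖τ i - t i‖ ≤ 2) → ∀ ψ : F →+* ℂ, Over τ ψ → ∀ n k y, e + 1 ≤ n → k ≤ n →
      ev ψ fF n y = (cF.map ψ).eval y → ‖ψ (algebraMap (AA r) F L) * ev ψ fF k y‖ ≤ B)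
    (hbL : ∀ τ : Fin r → ℂ, (∀ i, ‖τ i - t i‖ ≤ 2) → ‖MvPolynomial.aeval τ L‖ ≤ B)
    (T : F[X]) (hT : T.Monic) (hTd : 1 ≤ T.natDegree)
    (hnear : ∀ τ, Gen τ → (∀ i, ‖τ i - t i‖ ≤ ρ) → ∃ ψ : F →+* ℂ, Over τ ψ ∧ ∀ n y, m ≤ n →
      ev ψ fF n y = (cF.map ψ).eval y → ev ψ gF n y = (cF.map ψ).eval y →
      ‖y‖ ≤ R ∧ ‖(T.map ψ).eval y‖ ≤ 1 / 2)
    (hinf : ∀ m : ℕ, {x : ℂ | ∃ n, m ≤ n ∧ ev ι fF n x = (cF.map ι).eval x ∧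
      ev ι gF n x = (cF.map ι).eval x}.Infinite) : False := by
  classical
  obtain ⟨K, hK⟩ := int_poly_lower (min ρ 2) (by positivity) (min_le_right _ _) r
  set h := Module.finrank (FractionRing (AA r)) F with hh
  obtain ⟨m0, M0, hnum⟩ := num_lemma fF.natDegree (h * (K + 1)) T.natDegree B R hd hTd hB hR
  set N := fF.natDegree ^ m0 with hN
  have hNpos : 0 < N := by rw [hN]; positivity
  obtain ⟨Q, hQm, hQs, hQd, hQr⟩ := exists_Q ι fF gF cF hd (max m (m0 + e + 1))
    (by have := le_max_right m (m0 + e + 1); omega) (hinf _) M0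
  set M := Q.natDegree with hM
  have hnum := hnum M hQd
  set Δ := resultant Q Q.derivative with hΔ
  have hΔ0 : Δ ≠ 0 := resultant_ne_zero _ _ hQs
  have hdisc : ∀ ψ : F →+* ℂ, ∃ y : Fin M → ℂ, (∀ i, (Q.map ψ).IsRoot (y i)) ∧ ∃ s : ℂ, (s = 1 ∨ s = -1) ∧
      ψ Δ = s * (Matrix.vandermonde y).det ^ 2 := by
    intro ψ
    have := disc_exists' (Q.map ψ) (hQm.map ψ) M Q.derivative.natDegree (natDegree_map ψ)
      (by rw [derivative_map, natDegree_map])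
    rw [derivative_map, resultant_map_map] at this
    exact this
  set a := M * (N + M / N) with ha
  set x : F := (algebraMap (AA r) F L) ^ (2 * a) * Δ with hx
  have hLF : algebraMap (AA r) F L ≠ 0 := by
    intro h0
    have := hι L
    rw [h0, map_zero] at this
    exact hL (ht (by rw [← this, map_zero]))
  have hx0 : x ≠ 0 := mul_ne_zero (pow_ne_zero _ hLF) hΔ0
  have hxψ : ∀ ψ : F →+* ℂ, ∀ y : Fin M → ℂ, ∀ s : ℂ, ψ Δ = s * (Matrix.vandermonde y).det ^ 2 →
      ψ x = s * (ψ (algebraMap (AA r) F L) ^ a * (Matrix.vandermonde y).det) ^ 2 := by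
    intro ψ y s h1
    rw [hx, map_mul, map_pow, h1]; ring
  have hitm : ∀ ψ : F →+* ℂ, ((itr fF m0).map ψ).Monic := fun ψ => (itr_monic fF hfm (by omega) m0).map ψ
  have hitd : ∀ ψ : F →+* ℂ, ((itr fF m0).map ψ).natDegree = N := fun ψ => by
    rw [natDegree_map, itr_natDegree]
  -- integrality
  have hxint : IsIntegral (AA r) x := by
    let ι' : F →ₐ[AA r] ℂ := { ι with commutes' := fun a => by rw [halg]; exact hι a }
    rw [← isIntegral_algHom_iff ι' ι.injective]
    change IsIntegral (AA r) (ι x)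
    obtain ⟨y, hy, s, hs, h1⟩ := hdisc ι
    rw [hxψ ι y s h1]
    have hsI : IsIntegral (AA r) s := by
      rcases hs with rfl | rfl
      · exact isIntegral_one
      · exact isIntegral_one.neg
    refine hsI.mul (IsIntegral.pow ?_ 2)
    have h2 := vand_integral (A := AA r) y ((itr fF m0).map ι) (hitm ι) (by rw [hitd]; exact hNpos)
      (algebraMap (AA r) ℂ L) isIntegral_algebraMap ?_ ?_
    · rw [hitd, halg, ← hι] at h2
      exact h2
    · intro i
      obtain ⟨n, hn, h3, h4⟩ := hQr ι (y i) (hy i)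
      have hn' := (le_max_right _ _).trans hn
      exact hInteg n 0 (y i) (by omega) (by omega) h3
    · intro i
      obtain ⟨n, hn, h3, h4⟩ := hQr ι (y i) (hy i)
      have hn' := (le_max_right _ _).trans hn
      rw [← ev_eq]
      exact hInteg n m0 (y i) (by omega) (by omega) h3
  obtain ⟨Z, hZ⟩ := IsIntegrallyClosed.isIntegral_iff.1 (Algebra.isIntegral_norm (FractionRing (AA r)) hxint)
  have hZ0 : Z ≠ 0 := by
    rintro rfl
    rw [map_zero] at hZ
    exact (Algebra.norm_ne_zero_iff.2 hx0) hZ.symm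
  set b : ℝ := (M.factorial : ℝ) ^ 2 * B ^ (2 * a) with hb
  have hfac : (1 : ℝ) ≤ M.factorial := by exact_mod_cast M.factorial_pos
  have hb1 : 1 ≤ b := one_le_mul_of_one_le_of_one_le (one_le_pow₀ hfac) (one_le_pow₀ hB)
  set w : ℝ := (R ^ (T.natDegree * M) * (1 / 2) ^ (∑ k ∈ Finset.range M, k / T.natDegree)) ^ 2 with hw
  have hsn : ∀ s : ℂ, (s = 1 ∨ s = -1) → ‖s‖ = 1 := by
    rintro s (rfl | rfl) <;> simp
  -- bound for all embeddings
  have hall : ∀ τ, Gen τ → (∀ i, ‖τ i - t i‖ ≤ 2) → ∀ ψ : F →+* ℂ, Over τ ψ → ‖ψ x‖ ≤ b := by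
    intro τ hτ hτ2 ψ hψ
    obtain ⟨y, hy, s, hs, h1⟩ := hdisc ψ
    rw [hxψ ψ y s h1, norm_mul, hsn s hs, one_mul, norm_pow]
    have h2 := vand_bound y ((itr fF m0).map ψ) (hitm ψ) (by rw [hitd]; exact hNpos)
      (ψ (algebraMap (AA r) F L)) B hB (by rw [hψ]; exact hbL τ hτ2) ?_ ?_
    · rw [hitd, ← ha] at h2
      calc _ ≤ ((M.factorial : ℝ) * B ^ a) ^ 2 := by gcongr
        _ = b := by rw [hb]; ring
    · intro i
      obtain ⟨n, hn, h3, h4⟩ := hQr ψ (y i) (hy i)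
      have hn' := (le_max_right _ _).trans hn
      exact hbd τ hτ hτ2 ψ hψ n 0 (y i) (by omega) (by omega) h3
    · intro i
      obtain ⟨n, hn, h3, h4⟩ := hQr ψ (y i) (hy i)
      have hn' := (le_max_right _ _).trans hn
      rw [← ev_eq]
      exact hbd τ hτ hτ2 ψ hψ n m0 (y i) (by omega) (by omega) h3
  have hS : ∀ τ : Fin r → ℂ, (∀ i, ‖τ i - t i‖ ≤ 2) → ‖MvPolynomial.aeval τ Z‖ ≤ b ^ h := by
    apply extend_bound t Z 2 _ (by norm_num)
    intro τ hτ hτ2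
    obtain ⟨Ψ, hΨc, hΨ, hΨn⟩ := L_norm (F := F) hτ
    rw [hΨn x Z hZ.symm, norm_prod, hh, ← hΨc, ← Finset.prod_const]
    exact Finset.prod_le_prod (fun _ _ => norm_nonneg _) fun ψ hψ => hall τ hτ hτ2 ψ ((hΨ ψ).1 hψ)
  have hs : ∀ τ : Fin r → ℂ, (∀ i, ‖τ i - t i‖ ≤ min ρ 2) → ‖MvPolynomial.aeval τ Z‖ ≤ b ^ h * w := by
    apply extend_bound t Z _ _ (by positivity)
    intro τ hτ hτ2
    obtain ⟨Ψ, hΨc, hΨ, hΨn⟩ := L_norm (F := F) hτ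
    obtain ⟨ψ, hψ, hψy⟩ := hnear τ hτ fun i => (hτ2 i).trans (min_le_left _ _)
    have hτ2' : ∀ i, ‖τ i - t i‖ ≤ 2 := fun i => (hτ2 i).trans (min_le_right _ _)
    have hmem := (hΨ ψ).2 hψ
    rw [hΨn x Z hZ.symm, norm_prod, ← Finset.mul_prod_erase Ψ _ hmem]
    have h1 : ∏ φ ∈ Ψ.erase ψ, ‖φ x‖ ≤ b ^ (h - 1) := by
      rw [hh, ← hΨc, ← Finset.card_erase_of_mem hmem, ← Finset.prod_const]
      exact Finset.prod_le_prod (fun _ _ => norm_nonneg _) fun φ hφ =>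
        hall τ hτ hτ2' φ ((hΨ φ).1 (Finset.mem_of_mem_erase hφ))
    have h2 : ‖ψ x‖ ≤ b * w := by
      obtain ⟨y, hy, s, hs, h1⟩ := hdisc ψ
      rw [hxψ ψ y s h1, norm_mul, hsn s hs, one_mul, norm_pow, norm_mul, norm_pow]
      have hyy : ∀ i, ‖y i‖ ≤ R ∧ ‖(T.map ψ).eval (y i)‖ ≤ 1 / 2 := by
        intro i
        obtain ⟨n, hn, h3, h4⟩ := hQr ψ (y i) (hy i)
        exact hψy n (y i) ((le_max_left _ _).trans hn) h3 h4
      have h2 := vand_bound_near y (T.map ψ) (hT.map ψ) (by rw [natDegree_map]; omega) R hR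
        (fun i => (hyy i).1) fun i => (hyy i).2
      rw [natDegree_map] at h2
      have h3 : ‖ψ (algebraMap (AA r) F L)‖ ≤ B := by rw [hψ]; exact hbL τ hτ2'
      calc _ ≤ (B ^ a * (M.factorial * (R ^ (T.natDegree * M) * (1 / 2) ^ (∑ k ∈ Finset.range M, k / T.natDegree)))) ^ 2 := by
            gcongr
        _ = b * w := by rw [hb, hw]; ring
    have hh1 : 1 ≤ h := by
      rw [hh, ← hΨc]; exact Finset.card_pos.2 ⟨ψ, hmem⟩
    calc _ ≤ (b * w) * b ^ (h - 1) := by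
          apply mul_le_mul h2 h1 (Finset.prod_nonneg fun _ _ => norm_nonneg _) 
          positivity
      _ = b ^ (h - 1 + 1) * w := by ring
      _ = _ := by rw [Nat.sub_add_cancel hh1]
  have hfin := hK t Z (b ^ h) (b ^ h * w) hZ0 (one_le_pow₀ hb1) hS hs
  have heq : (b ^ h) ^ K * (b ^ h * w) = b ^ (h * (K + 1)) * w := by
    rw [← pow_mul, ← mul_assoc, ← pow_add, mul_add, mul_one]
  rw [heq] at hfin
  exact absurd hfin (not_le.2 hnum)
end

section

lemma far_data {r : ℕ} {F : Type} [Field F] [Algebra (AA r) F] [Algebra (FractionRing (AA r)) F]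
    [IsScalarTower (AA r) (FractionRing (AA r)) F] [FiniteDimensional (FractionRing (AA r)) F]
    [Algebra (AA r) ℂ] {t : Fin r → ℂ}
    (halg : ∀ a : AA r, algebraMap (AA r) ℂ a = MvPolynomial.aeval t a)
    (ι : F →+* ℂ) (hι : Over t ι) (fF cF : F[X]) (hfm : fF.Monic) (hd : 2 ≤ fF.natDegree)
    (e : ℕ) (he : cF.natDegree ≤ e) :
    ∃ (L : AA r) (B : ℝ), L ≠ 0 ∧ 1 ≤ B ∧
    (∀ n k y, e + 1 ≤ n → k + e ≤ n → ev ι fF n y = (cF.map ι).eval y →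
      IsIntegral (AA r) (algebraMap (AA r) ℂ L * ev ι fF k y)) ∧
    (∀ τ, Gen τ → (∀ i, ‖τ i - t i‖ ≤ 2) → ∀ ψ : F →+* ℂ, Over τ ψ → ∀ n k y, e + 1 ≤ n → k ≤ n →
      ev ψ fF n y = (cF.map ψ).eval y → ‖ψ (algebraMap (AA r) F L) * ev ψ fF k y‖ ≤ B) ∧
    (∀ τ : Fin r → ℂ, (∀ i, ‖τ i - t i‖ ≤ 2) → ‖MvPolynomial.aeval τ L‖ ≤ B) := by
  classical
  obtain ⟨C₀, κ, hC, hesc⟩ := escape fF.natDegree e hd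
  set S : Finset F := insert 0 (fF.coeffs ∪ cF.coeffs) with hS
  have hSf : ∀ i, fF.coeff i ∈ S := by
    intro i
    by_cases h : fF.coeff i = 0
    · rw [h]; simp [hS]
    · have := coeff_mem_coeffs h
      simp [hS, this]
  have hSc : ∀ i, cF.coeff i ∈ S := by
    intro i
    by_cases h : cF.coeff i = 0
    · rw [h]; simp [hS]
    · have := coeff_mem_coeffs h
      simp [hS, this]
  obtain ⟨Λ, hΛ, hΛi⟩ := exists_integral_multiples (AA r) (FractionRing (AA r)) S
  have hbdd : ∀ a : S, ∃ B, ∀ τ : Fin r → ℂ, (∀ i, ‖τ i - t i‖ ≤ 2) → ∀ ψ : F →+* ℂ, Over τ ψ →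
      ‖ψ (Λ • (a : F))‖ ≤ B := fun a => L_bdd t _ (hΛi a a.2)
  choose Bf hBf using hbdd
  obtain ⟨BΛ, hBΛ⟩ := coef_bdd t Λ
  set B0 : ℝ := 1 + |BΛ| + ∑ a : S, |Bf a| with hB0
  have hsum : 0 ≤ ∑ a : S, |Bf a| := Finset.sum_nonneg fun _ _ => abs_nonneg _
  have hB01 : 1 ≤ B0 := by have := abs_nonneg BΛ; linarith
  have hB0Λ : ∀ τ : Fin r → ℂ, (∀ i, ‖τ i - t i‖ ≤ 2) → ‖MvPolynomial.aeval τ Λ‖ ≤ B0 := by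
    intro τ h
    have := hBΛ τ h; have := le_abs_self BΛ; linarith
  have hB0S : ∀ a ∈ S, ∀ τ : Fin r → ℂ, (∀ i, ‖τ i - t i‖ ≤ 2) → ∀ ψ : F →+* ℂ, Over τ ψ →
      ‖MvPolynomial.aeval τ Λ * ψ a‖ ≤ B0 := by
    intro a ha τ hτ ψ hψ
    have h1 := hBf ⟨a, ha⟩ τ hτ ψ hψ
    rw [Algebra.smul_def, map_mul, hψ] at h1
    have h2 := Finset.single_le_sum (f := fun a : S => |Bf a|) (fun _ _ => abs_nonneg _) (Finset.mem_univ (⟨a, ha⟩ : S))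
    have h3 := le_abs_self (Bf ⟨a, ha⟩)
    have := abs_nonneg BΛ
    simp only at h2 h1
    linarith
  have hpow : B0 ^ (κ+1) ≤ C₀ * B0 ^ (κ+1) := le_mul_of_one_le_left (by positivity) hC
  refine ⟨Λ ^ (κ+1), C₀ * B0 ^ (κ+1), pow_ne_zero _ hΛ, ?_, ?_, ?_, ?_⟩
  · exact (one_le_pow₀ hB01).trans hpow
  · intro n k y hn hk hy
    have hmap : ∀ a : F, IsIntegral (AA r) a → IsIntegral (AA r) (ι a) := by
      intro a ha
      exact ha.map ({ ι with commutes' := fun a => by rw [halg a]; exact hι a } : F →ₐ[AA r] ℂ)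
    have hmap2 : ∀ a ∈ S, IsIntegral (AA r) (algebraMap (AA r) ℂ Λ * ι a) := by
      intro a ha
      have := hmap _ (hΛi a ha)
      rwa [Algebra.smul_def, map_mul, hι, ← halg] at this
    have := integ (A := AA r) (fF.map ι) (cF.map ι) (hfm.map ι) (by rw [natDegree_map]; exact hd) e
      (by rw [natDegree_map]; exact he) (algebraMap (AA r) ℂ Λ) isIntegral_algebraMap
      (fun i => by rw [coeff_map]; exact hmap2 _ (hSf i))
      (fun i => by rw [coeff_map]; exact hmap2 _ (hSc i)) n hn y hy k hk
    rw [pow_succ, map_mul, mul_assoc]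
    exact isIntegral_algebraMap.mul this
  · intro τ hτ hτ2 ψ hψ n k y hn hk hy
    rw [hψ, map_pow]
    set z := MvPolynomial.aeval τ Λ with hz
    have hz0 : z ≠ 0 := by
      intro h
      exact hΛ (hτ (by rw [← hz, h, map_zero]))
    have hzp : 0 < ‖z‖ := norm_pos_iff.2 hz0
    have hzB := hB0Λ τ hτ2
    rw [← hz] at hzB
    have hq : 1 ≤ B0 / ‖z‖ := by rwa [le_div_iff₀ hzp, one_mul]
    have hco : ∀ a ∈ S, ‖ψ a‖ ≤ B0 / ‖z‖ := by
      intro a ha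
      have := hB0S a ha τ hτ2 ψ hψ
      rw [norm_mul] at this
      rw [le_div_iff₀ hzp, mul_comm]; exact this
    have := hesc (B0 / ‖z‖) hq (fF.map ψ) (cF.map ψ) (natDegree_map ψ) (by rw [natDegree_map]; exact he)
      (fun i => by rw [coeff_map]; exact hco _ (hSf i)) (fun i => by rw [coeff_map]; exact hco _ (hSc i))
      (by rw [(hfm.map ψ).leadingCoeff]; simpa using hq) n hn y hy k hk
    rw [norm_mul, norm_pow]
    change _ * ‖(fun y => (fF.map ψ).eval y)^[k] y‖ ≤ _
    calc _ ≤ ‖z‖^(κ+1) * (C₀ * (B0 / ‖z‖)^κ) := by gcongr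
      _ = C₀ * B0 ^ κ * ‖z‖ := by rw [div_pow, pow_succ]; field_simp
      _ ≤ C₀ * B0 ^ κ * B0 := by gcongr
      _ = _ := by ring
  · intro τ hτ
    rw [map_pow, norm_pow]
    exact (pow_le_pow_left₀ (norm_nonneg _) (hB0Λ τ hτ) _).trans hpow

lemma near_data {r : ℕ} {F : Type} [Field F] [CharZero F] [Algebra (AA r) F] [Algebra (FractionRing (AA r)) F]
    [IsScalarTower (AA r) (FractionRing (AA r)) F] [FiniteDimensional (FractionRing (AA r)) F]
    {t : Fin r → ℂ} (ht : Gen t)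
    (ι : F →+* ℂ) (hι : Over t ι) (fF gF cF : F[X]) (hfm : fF.Monic) (hd : 2 ≤ fF.natDegree)
    (hg : gF.natDegree = fF.natDegree) (hgl : 1 ≤ ‖ι gF.leadingCoeff‖) (m1 : ℕ)
    (hm1 : 1 ≤ (hdiff fF gF m1).natDegree) :
    ∃ (R ρ : ℝ) (m : ℕ) (T : F[X]), 1 ≤ R ∧ 0 < ρ ∧ T.Monic ∧ 1 ≤ T.natDegree ∧
    (∀ τ, Gen τ → (∀ i, ‖τ i - t i‖ ≤ ρ) → ∃ ψ : F →+* ℂ, Over τ ψ ∧ ∀ n y, m ≤ n →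
      ev ψ fF n y = (cF.map ψ).eval y → ev ψ gF n y = (cF.map ψ).eval y →
      ‖y‖ ≤ R ∧ ‖(T.map ψ).eval y‖ ≤ 1 / 2) := by
  classical
  set e := cF.natDegree with he
  obtain ⟨C₀, κ, hC, hesc⟩ := escape fF.natDegree e hd
  set S : Finset F := insert 0 (fF.coeffs ∪ cF.coeffs ∪ gF.coeffs) with hS
  have hSf : ∀ i, fF.coeff i ∈ S := by
    intro i
    by_cases h : fF.coeff i = 0
    · rw [h]; simp [hS]
    · have := coeff_mem_coeffs h
      simp [hS, this]
  have hSc : ∀ i, cF.coeff i ∈ S := by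
    intro i
    by_cases h : cF.coeff i = 0
    · rw [h]; simp [hS]
    · have := coeff_mem_coeffs h
      simp [hS, this]
  have hSg : ∀ i, gF.coeff i ∈ S := by
    intro i
    by_cases h : gF.coeff i = 0
    · rw [h]; simp [hS]
    · have := coeff_mem_coeffs h
      simp [hS, this]
  set B1 : ℝ := 2 + ∑ a ∈ S, ‖ι a‖ with hB1
  have hB1S : ∀ a ∈ S, ‖ι a‖ + 1 ≤ B1 := by
    intro a ha
    have := Finset.single_le_sum (f := fun a : F => ‖ι a‖) (fun _ _ => norm_nonneg _) ha
    linarith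
  have hB12 : 2 ≤ B1 := by
    have : 0 ≤ ∑ a ∈ S, ‖ι a‖ := Finset.sum_nonneg fun _ _ => norm_nonneg _
    linarith
  set C1 : ℝ := C₀ * B1 ^ κ with hC1
  have hC11 : 1 ≤ C1 := one_le_mul_of_one_le_of_one_le hC (one_le_pow₀ (by linarith))
  have hgrow := hdiff_growth fF gF fF.natDegree hd rfl hfm hg m1 hm1
  have hl0 : 0 < ‖ι (hdiff fF gF m1).leadingCoeff‖ := by
    rw [norm_pos_iff, Ne, map_eq_zero, leadingCoeff_eq_zero]
    intro h; rw [h] at hm1; simp at hm1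
  obtain ⟨j, hj⟩ := pow_unbounded_of_one_lt ((6 * C1 + 1) / ‖ι (hdiff fF gF m1).leadingCoeff‖)
    (show (1:ℝ) < fF.natDegree by exact_mod_cast hd)
  rw [div_lt_iff₀ hl0] at hj
  obtain ⟨hh1, hh2⟩ := hgrow j
  set m2 := m1 + j with hm2
  set η := (hdiff fF gF m2).leadingCoeff with hη
  set β := ((itr gF m2).leadingCoeff)⁻¹ with hβ
  have hη6 : 6 * C1 + 1 ≤ ‖ι η‖ := by
    rw [hh2, map_mul, map_pow, map_natCast, norm_mul, norm_pow, Complex.norm_natCast]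
    exact hj.le
  have hη0 : η ≠ 0 := by
    intro h; rw [h, map_zero, norm_zero] at hη6; linarith
  have hlead : ∀ n, 1 ≤ ‖ι (itr gF n).leadingCoeff‖ := by
    intro n
    induction n with
    | zero => simp [itr_zero]
    | succ n ih =>
      rw [itr_lead_succ gF (by omega), map_mul, map_pow, norm_mul, norm_pow]
      exact one_le_mul_of_one_le_of_one_le hgl (one_le_pow₀ ih)
  have hβ1 : ‖ι β‖ ≤ 1 := by
    rw [hβ, map_inv₀, norm_inv]
    exact inv_le_one_of_one_le₀ (hlead m2)
  obtain ⟨ρ, hρ, hnear⟩ := L_near ht ι hι (insert η (insert β S)) (1/2) (by norm_num)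
  refine ⟨C1, ρ, max m2 (e+1), C η⁻¹ * hdiff fF gF m2, hC11, hρ, ?_, ?_, ?_⟩
  · rw [Monic, leadingCoeff_mul, leadingCoeff_C, ← hη, inv_mul_cancel₀ hη0]
  · rw [natDegree_C_mul (inv_ne_zero hη0)]; exact hh1
  · intro τ hτ hτρ
    obtain ⟨ψ, hψ, hclose⟩ := hnear τ hτ hτρ
    refine ⟨ψ, hψ, ?_⟩
    intro n y hn hf hgn
    have hco : ∀ a ∈ S, ‖ψ a‖ ≤ B1 := by
      intro a ha
      have h1 := hclose a (by simp [ha])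
      have h2 := hB1S a ha
      have h3 := norm_le_norm_add_norm_sub' (ψ a) (ι a)
      linarith
    have hgψ : 1 / 2 ≤ ‖ψ gF.leadingCoeff‖ := by
      have h1 := hclose gF.leadingCoeff (by have := hSg gF.natDegree; rw [coeff_natDegree] at this; simp [this])
      have h3 := norm_le_norm_add_norm_sub' (ι gF.leadingCoeff) (ψ gF.leadingCoeff)
      rw [norm_sub_rev] at h1
      linarith
    have hηψ : 6 * C1 + 1 / 2 ≤ ‖ψ η‖ := by
      have h1 := hclose η (by simp)
      have h3 := norm_le_norm_add_norm_sub' (ι η) (ψ η)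
      rw [norm_sub_rev] at h1
      linarith
    have hβψ : ‖ψ β‖ ≤ 2 := by
      have h1 := hclose β (by simp)
      have h3 := norm_le_norm_add_norm_sub' (ψ β) (ι β)
      linarith
    have hnm := le_max_left m2 (e+1)
    have hne := le_max_right m2 (e+1)
    have ef := hesc B1 (by linarith) (fF.map ψ) (cF.map ψ) (natDegree_map ψ) (natDegree_map ψ).le
      (fun i => by rw [coeff_map]; exact hco _ (hSf i)) (fun i => by rw [coeff_map]; exact hco _ (hSc i))
      (by rw [(hfm.map ψ).leadingCoeff]; simp; linarith) n (by omega) y hf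
    have eg := hesc B1 (by linarith) (gF.map ψ) (cF.map ψ) (by rw [natDegree_map, hg]) (natDegree_map ψ).le
      (fun i => by rw [coeff_map]; exact hco _ (hSg i)) (fun i => by rw [coeff_map]; exact hco _ (hSc i))
      (by rw [leadingCoeff_map]; nlinarith) n (by omega) y hgn
    have ef0 := ef 0 (by omega)
    have ef2 := ef m2 (by omega)
    have eg2 := eg m2 (by omega)
    refine ⟨ef0, ?_⟩
    have hT : ((C η⁻¹ * hdiff fF gF m2).map ψ).eval y =
        (ψ η)⁻¹ * ((fun y => (fF.map ψ).eval y)^[m2] y - ψ β * (fun y => (gF.map ψ).eval y)^[m2] y) := by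
      simp only [hdiff, Polynomial.map_mul, Polynomial.map_sub, map_C, eval_mul, eval_C, eval_sub, itr_map, itr_eval,
        map_inv₀, hβ]
    rw [hT, norm_mul, norm_inv]
    have h1 : ‖(fun y => (fF.map ψ).eval y)^[m2] y - ψ β * (fun y => (gF.map ψ).eval y)^[m2] y‖ ≤ C1 + 2 * C1 := by
      refine (norm_sub_le _ _).trans ?_
      rw [norm_mul]
      gcongr
    have hp : 0 < ‖ψ η‖ := by linarith
    rw [inv_mul_le_iff₀ hp]
    linarith

theorem main_fin (d : ℕ) (hd : 2 ≤ d) (f g c : ℂ[X]) (hfm : f.Monic) (hf : f.natDegree = d)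
    (hg : g.natDegree = d) (hgl : 1 ≤ ‖g.leadingCoeff‖) (m1 : ℕ) (hm1 : 1 ≤ (hdiff f g m1).natDegree) :
    ∃ m : ℕ, {x : ℂ | ∃ n, m ≤ n ∧ (fun y => f.eval y)^[n] x = c.eval x ∧
      (fun y => g.eval y)^[n] x = c.eval x}.Finite := by
  classical
  by_contra hcon
  push Not at hcon
  obtain ⟨r, t, F, i1, i2, i3, i4, i5, ι, ht, hι, hs⟩ := field_setup (insert 0 (f.coeffs ∪ g.coeffs ∪ c.coeffs))
  have lift : ∀ p : ℂ[X], (∀ i, p.coeff i ≠ 0 → p.coeff i ∈ insert 0 (f.coeffs ∪ g.coeffs ∪ c.coeffs)) →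
      ∃ q : F[X], q.map ι = p := by
    intro p hp
    rw [← mem_lifts, lifts_iff_coeff_lifts]
    intro n
    by_cases h : p.coeff n = 0
    · exact ⟨0, by simp [h]⟩
    · exact hs _ (hp n h)
  obtain ⟨fF, rfl⟩ := lift f (fun i h => by have := coeff_mem_coeffs h; simp [this])
  obtain ⟨gF, rfl⟩ := lift g (fun i h => by have := coeff_mem_coeffs h; simp [this])
  obtain ⟨cF, rfl⟩ := lift c (fun i h => by have := coeff_mem_coeffs h; simp [this])
  have : CharZero F := ⟨fun a b h => by have := congrArg ι h; simpa using this⟩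
  let _ : Algebra (AA r) ℂ := (MvPolynomial.aeval t : AA r →ₐ[ℤ] ℂ).toRingHom.toAlgebra
  have halg : ∀ a : AA r, algebraMap (AA r) ℂ a = MvPolynomial.aeval t a := fun a => rfl
  rw [natDegree_map] at hf hg
  rw [leadingCoeff_map] at hgl
  have hfm' : fF.Monic := monic_of_injective ι.injective hfm
  have hm1' : 1 ≤ (hdiff fF gF m1).natDegree := by
    have : (hdiff fF gF m1).map ι = hdiff (fF.map ι) (gF.map ι) m1 := by
      simp only [hdiff, Polynomial.map_sub, Polynomial.map_mul, map_C, itr_map, map_inv₀]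
      rw [← itr_map ι gF, leadingCoeff_map]
    rw [← this, natDegree_map] at hm1
    exact hm1
  obtain ⟨L, B, hL, hB, hInteg, hbd, hbL⟩ := far_data halg ι hι fF cF hfm' (by omega) cF.natDegree le_rfl
  obtain ⟨R, ρ, m, T, hR, hρ, hT, hTd, hnear⟩ := near_data ht ι hι fF gF cF hfm' (by omega) (by omega) hgl m1 hm1'
  exact core ht halg ι hι fF gF cF hfm' (by omega) L hL B R ρ hB hR hρ m cF.natDegree le_rfl hInteg hbd hbL T hT hTd
    hnear hcon
end

section

/-- eventually periodic predicates -/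
def EP (P : ℕ → Prop) : Prop := ∃ N k : ℕ, 0 < k ∧ ∀ n, N ≤ n → (P (n + k) ↔ P n)

lemma EP.per {P : ℕ → Prop} {N k : ℕ} (h : ∀ n, N ≤ n → (P (n + k) ↔ P n)) (j n : ℕ) (hn : N ≤ n) :
    P (n + k * j) ↔ P n := by
  induction j with
  | zero => simp
  | succ j ih =>
    rw [← ih, mul_add, mul_one, ← add_assoc]
    exact h _ (by omega)

lemma EP.op {P Q : ℕ → Prop} (hP : EP P) (hQ : EP Q) (r : Prop → Prop → Prop) : EP (fun n => r (P n) (Q n)) := by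
  obtain ⟨N, k, hk, h⟩ := hP
  obtain ⟨N', k', hk', h'⟩ := hQ
  refine ⟨max N N', k * k', by positivity, fun n hn => ?_⟩
  have h1 : P (n + k * k') = P n := propext (EP.per h k' n ((le_max_left _ _).trans hn))
  have h2 : Q (n + k * k') = Q n := by
    rw [mul_comm]; exact propext (EP.per h' k n ((le_max_right _ _).trans hn))
  beta_reduce; rw [h1, h2]

lemma EP.of_eventually {P Q : ℕ → Prop} (hQ : EP Q) (m : ℕ) (h : ∀ n, m ≤ n → (P n ↔ Q n)) : EP P := by
  obtain ⟨N, k, hk, h'⟩ := hQ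
  refine ⟨max N m, k, hk, fun n hn => ?_⟩
  have h1 := (le_max_left _ _).trans hn
  have h2 := (le_max_right _ _).trans hn
  rw [h n h2, h (n + k) (by omega)]
  exact h' n h1

lemma EP.const (p : Prop) : EP (fun _ => p) := ⟨0, 1, one_pos, fun _ _ => Iff.rfl⟩

lemma EP.fin {α : Type*} {s : Set α} (hs : s.Finite) (P : α → ℕ → Prop) (h : ∀ x, EP (P x)) :
    EP (fun n => ∃ x ∈ s, P x n) := by
  induction s, hs using Set.Finite.induction_on with
  | empty => simpa using EP.const False
  | insert ha hs ih =>
    rename_i a s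
    refine EP.of_eventually ((h a).op ih Or) 0 fun n _ => ?_
    simp

lemma EP.hit {α : Type*} (F : α → α) (x y : α) : EP (fun n => F^[n] x = y) := by
  by_cases hb : ∃ m, ∀ n, m ≤ n → ¬ F^[n] x = y
  · obtain ⟨m, hm⟩ := hb
    exact EP.of_eventually (EP.const False) m fun n hn => by simp [hm n hn]
  · push Not at hb
    obtain ⟨n1, -, h1⟩ := hb 0
    obtain ⟨n2, hn2, h2⟩ := hb (n1 + 1)
    refine ⟨n1, n2 - n1, by omega, fun n hn => ?_⟩
    have e1 : n + (n2 - n1) = (n - n1) + n2 := by omega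
    have e2 : n = (n - n1) + n1 := by omega
    beta_reduce; rw [e1, Function.iterate_add_apply, h2]
    conv_rhs => rw [e2, Function.iterate_add_apply, h1]

lemma EP.ap {P : ℕ → Prop} (hP : EP P) : ∃ s : Finset (ℕ × ℕ),
    {n : ℕ | P n} = ⋃ p ∈ s, {n : ℕ | ∃ k : ℕ, n = p.1 + p.2 * k} := by
  classical
  obtain ⟨N, k, hk, h⟩ := hP
  refine ⟨((Finset.range N).filter P).image (fun n => (n, 0)) ∪
    ((Finset.Ico N (N + k)).filter P).image (fun n => (n, k)), ?_⟩
  ext n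
  simp only [Set.mem_iUnion, Finset.mem_union, Finset.mem_image, Finset.mem_filter, Finset.mem_range,
    Finset.mem_Ico, Set.mem_ofPred_eq, exists_prop]
  constructor
  · intro hn
    by_cases hN : n < N
    · exact ⟨(n, 0), Or.inl ⟨n, ⟨hN, hn⟩, rfl⟩, 0, by simp⟩
    · have hdm := Nat.mod_add_div (n - N) k
      have hlt := Nat.mod_lt (n - N) hk
      have e : n = (N + (n - N) % k) + k * ((n - N) / k) := by omega
      refine ⟨(N + (n - N) % k, k), Or.inr ⟨N + (n - N) % k, ⟨⟨by omega, by omega⟩, ?_⟩, rfl⟩, (n - N) / k, e⟩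
      rw [e] at hn
      exact (EP.per h _ _ (by omega)).1 hn
  · rintro ⟨p, ⟨a, ⟨ha, hPa⟩, rfl⟩ | ⟨a, ⟨ha, hPa⟩, rfl⟩, j, rfl⟩
    · simpa using hPa
    · exact (EP.per h _ _ (by omega)).2 hPa
end

section

lemma coeff_aff (f : ℂ[X]) (d : ℕ) (hd : 2 ≤ d) (hf : f.natDegree = d) (a b : ℂ) :
    (f.comp (C a * X + C b)).coeff d = f.leadingCoeff * a ^ d ∧
    (f.comp (C a * X + C b)).coeff (d-1) = (f.coeff (d-1) + d * f.leadingCoeff * b) * a ^ (d-1) := by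
  have h : f.comp (C a * X + C b) = (taylor b f).comp (C a * X) := by
    rw [taylor_apply, comp_assoc]; simp
  have hc : f.leadingCoeff = f.coeff d := by rw [← hf]; rfl
  rw [h, comp_C_mul_X_coeff, comp_C_mul_X_coeff, taylor_coeff, taylor_coeff, hc]
  constructor
  · congr 1
    have : (hasseDeriv d f).natDegree = 0 := by
      have := natDegree_hasseDeriv_le f d; omega
    rw [eq_C_of_natDegree_eq_zero this, hasseDeriv_coeff]; simp
  · congr 1
    have : (hasseDeriv (d-1) f).natDegree ≤ 1 := by
      have := natDegree_hasseDeriv_le f (d-1); omega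
    rw [eq_X_add_C_of_natDegree_le_one this, hasseDeriv_coeff, hasseDeriv_coeff]
    have e : 1 + (d - 1) = d := by omega
    have e2 : d.choose (d-1) = d := by
      rw [Nat.choose_symm_of_eq_add (show d = (d-1) + 1 by omega)]; simp
    simp [e, e2]; ring

lemma key_aff (f : ℂ[X]) (d : ℕ) (hd : 2 ≤ d) (hf : f.natDegree = d) (hfm : f.Monic)
    (hcen : f.coeff (d-1) = 0) (A B q p v : ℂ) (hq : q ≠ 0) (hA : A ≠ 0)
    (h : ∀ u, q * f.eval (A * u + B) = p * f.eval u + v) : B = 0 ∧ q * A ^ d = p := by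
  have hpoly : C q * f.comp (C A * X + C B) = C p * f + C v := by
    apply Polynomial.funext
    intro u
    have := h u
    simpa [eval_comp] using this
  obtain ⟨h1, h2⟩ := coeff_aff f d hd hf A B
  have hd1 : f.coeff d = 1 := by rw [← hf]; exact hfm
  constructor
  · have := congrArg (fun P => P.coeff (d-1)) hpoly
    simp only [coeff_C_mul, coeff_add, h2, hcen, coeff_C, show d - 1 ≠ 0 by omega, if_false, hfm.leadingCoeff] at this
    have hdc : (d:ℂ) ≠ 0 := by exact_mod_cast (by omega : d ≠ 0)
    simpa [hq, hA, hdc] using this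
  · have := congrArg (fun P => P.coeff d) hpoly
    simp only [coeff_C_mul, coeff_add, h1, hd1, coeff_C, show d ≠ 0 by omega, if_false, hfm.leadingCoeff] at this
    simpa using this

/-- the solution predicate -/
def SS (f g c : ℂ[X]) (n : ℕ) : Prop :=
  ∃ x : ℂ, (fun y => f.eval y)^[n] x = c.eval x ∧ (fun y => g.eval y)^[n] x = c.eval x

lemma exists_root_iter (f c : ℂ[X]) (hd : 2 ≤ f.natDegree) (n : ℕ) (hn : c.natDegree + 1 ≤ n) :
    ∃ x, (fun y => f.eval y)^[n] x = c.eval x := by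
  have h1 : c.natDegree < (itr f n).natDegree := by
    rw [itr_natDegree]
    have : n < f.natDegree ^ n := Nat.lt_pow_self (by omega)
    omega
  have h2 : (itr f n - c).natDegree = (itr f n).natDegree := natDegree_sub_eq_left_of_natDegree_lt h1
  obtain ⟨x, hx⟩ := Complex.exists_root (f := itr f n - c) (natDegree_pos_iff_degree_pos.1 (by omega))
  refine ⟨x, ?_⟩
  rw [← itr_eval]
  simpa [IsRoot, sub_eq_zero] using hx

lemma caseB (d : ℕ) (hd : 2 ≤ d) (f g c : ℂ[X]) (hfm : f.Monic) (hf : f.natDegree = d)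
    (hcen : f.coeff (d-1) = 0)
    (hB : ∀ m, ∃ u v : ℂ, u ≠ 0 ∧ ∀ x, (fun y => g.eval y)^[m] x = u * (fun y => f.eval y)^[m] x + v) :
    EP (SS f g c) := by
  have hsurj : ∀ w, ∃ x, f.eval x = w := by
    intro w
    obtain ⟨x, hx⟩ := exists_root_iter f (C w) (by omega) 1 (by simp)
    exact ⟨x, by simpa using hx⟩
  obtain ⟨b, β, hb, h1⟩ := hB 1
  obtain ⟨u2, v2, hu2, h2⟩ := hB 2
  obtain ⟨u3, v3, hu3, h3⟩ := hB 3
  simp only [Function.iterate_succ, Function.iterate_zero, Function.comp, id] at h1 h2 h3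
  have hβ : β = 0 := by
    refine (key_aff f d hd hf hfm hcen b β b u2 (v2 - β) hb hb fun u => ?_).1
    obtain ⟨y, rfl⟩ := hsurj u
    have := h2 y
    rw [h1 (g.eval y), h1 y] at this
    linear_combination this
  subst hβ
  simp only [add_zero] at h1
  have k2 : ∀ u, b * f.eval (b * u) = u2 * f.eval u + v2 := by
    intro u
    obtain ⟨y, rfl⟩ := hsurj u
    have := h2 y
    rwa [h1 (g.eval y), h1 y] at this
  have hu2' : b * b ^ d = u2 := by
    refine (key_aff f d hd hf hfm hcen b 0 b u2 v2 hb hb fun u => ?_).2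
    rw [add_zero]; exact k2 u
  have hv2 : v2 = 0 := by
    refine (key_aff f d hd hf hfm hcen u2 v2 b u3 v3 hb hu2 fun u => ?_).1
    obtain ⟨w, rfl⟩ := hsurj u
    obtain ⟨y, rfl⟩ := hsurj w
    have := h3 y
    rw [h1 (g.eval (g.eval y)), h1 (g.eval y), h1 y, k2 (f.eval y)] at this
    exact this
  subst hv2
  have hfb : ∀ u, f.eval (b * u) = b ^ d * f.eval u := by
    intro u
    have := k2 u
    rw [← hu2', add_zero, mul_assoc] at this
    exact mul_left_cancel₀ hb this
  have hfbj : ∀ j u, f.eval (b ^ j * u) = (b ^ j) ^ d * f.eval u := by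
    intro j
    induction j with
    | zero => simp
    | succ j ih =>
      intro u
      rw [pow_succ', mul_assoc, hfb, ih, mul_pow, mul_assoc]
  have hz : ∀ n, (∃ j, (fun w => b * w ^ d)^[n] 1 = b ^ j) ∧
      ∀ x, (fun y => g.eval y)^[n] x = (fun w => b * w ^ d)^[n] 1 * (fun y => f.eval y)^[n] x := by
    intro n
    induction n with
    | zero => exact ⟨⟨0, by simp⟩, by simp⟩
    | succ n ih =>
      obtain ⟨⟨j, hj⟩, ih2⟩ := ih
      refine ⟨⟨j * d + 1, ?_⟩, fun x => ?_⟩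
      · rw [Function.iterate_succ_apply', hj]; ring
      · rw [Function.iterate_succ_apply', Function.iterate_succ_apply', Function.iterate_succ_apply', ih2, hj, h1, hfbj]
        ring
  have hE2 : EP (fun n => ∃ x : ℂ, (fun y => f.eval y)^[n] x = 0 ∧ c.eval x = 0) := by
    by_cases hc : c = 0
    · refine EP.of_eventually (EP.const True) 1 fun n hn => ?_
      subst hc
      obtain ⟨x, hx⟩ := exists_root_iter f 0 (by omega) n (by simpa using hn)
      simp only [iff_true]
      exact ⟨x, by simpa using hx, by simp⟩
    · have hfin : {x : ℂ | c.IsRoot x}.Finite := Polynomial.finite_setOfPred_isRoot hc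
      refine EP.of_eventually (EP.fin hfin (fun x n => (fun y => f.eval y)^[n] x = 0) fun x => EP.hit _ _ _) 0
        fun n _ => ?_
      constructor
      · rintro ⟨x, h, h'⟩; exact ⟨x, h', h⟩
      · rintro ⟨x, h, h'⟩; exact ⟨x, h', h⟩
  refine EP.of_eventually ((EP.hit (fun w => b * w ^ d) (1:ℂ) 1).op hE2 Or) (c.natDegree + 1) fun n hn => ?_
  constructor
  · rintro ⟨x, hx1, hx2⟩
    rw [(hz n).2, hx1] at hx2
    by_cases h0 : c.eval x = 0
    · right; exact ⟨x, by rw [hx1, h0], h0⟩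
    · left; exact mul_right_cancel₀ h0 (by rw [hx2, one_mul])
  · rintro (h | ⟨x, hx1, hx2⟩)
    · obtain ⟨x, hx⟩ := exists_root_iter f c (by omega) n hn
      exact ⟨x, hx, by rw [(hz n).2, h, one_mul, hx]⟩
    · exact ⟨x, by rw [hx1, hx2], by rw [(hz n).2, hx1, hx2, mul_zero]⟩

lemma norm_case (d : ℕ) (hd : 2 ≤ d) (f g c : ℂ[X]) (hfm : f.Monic) (hf : f.natDegree = d)
    (hcen : f.coeff (d-1) = 0) (hg : g.natDegree = d) (hgl : 1 ≤ ‖g.leadingCoeff‖) :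
    EP (SS f g c) := by
  by_cases h : ∃ m1, 1 ≤ (hdiff f g m1).natDegree
  · obtain ⟨m1, hm1⟩ := h
    obtain ⟨m, hfin⟩ := main_fin d hd f g c hfm hf hg hgl m1 hm1
    refine EP.of_eventually (EP.fin hfin
      (fun x n => (fun y => f.eval y)^[n] x = c.eval x ∧ (fun y => g.eval y)^[n] x = c.eval x)
      fun x => (EP.hit _ _ _).op (EP.hit _ _ _) And) m fun n hn => ?_
    constructor
    · rintro ⟨x, hx⟩
      exact ⟨x, ⟨n, hn, hx⟩, hx⟩
    · rintro ⟨x, -, hx⟩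
      exact ⟨x, hx⟩
  · push Not at h
    apply caseB d hd f g c hfm hf hcen
    intro m
    have h0 : (hdiff f g m).natDegree = 0 := by have := h m; omega
    have hu := itr_lead_ne g (by omega) m
    refine ⟨(itr g m).leadingCoeff, -((itr g m).leadingCoeff * (hdiff f g m).coeff 0), hu, fun x => ?_⟩
    have h1 := congrArg (fun P => P.eval x) (eq_C_of_natDegree_eq_zero h0)
    simp only [eval_C] at h1
    rw [← h1, hdiff, eval_sub, eval_mul, eval_C, itr_eval, itr_eval]
    field_simp
    ring

/-- affine conjugation -/
noncomputable def cj (a b : ℂ) (p : ℂ[X]) : ℂ[X] := C a⁻¹ * (p.comp (C a * X + C b) - C b)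

lemma cj_eval (a b : ℂ) (ha : a ≠ 0) (p : ℂ[X]) (x : ℂ) : a * (cj a b p).eval x + b = p.eval (a * x + b) := by
  simp [cj, eval_comp]; field_simp; ring

lemma cj_iter (a b : ℂ) (ha : a ≠ 0) (p : ℂ[X]) (n : ℕ) (x : ℂ) :
    a * (fun y => (cj a b p).eval y)^[n] x + b = (fun y => p.eval y)^[n] (a * x + b) := by
  induction n with
  | zero => simp
  | succ n ih => rw [Function.iterate_succ_apply', Function.iterate_succ_apply', cj_eval a b ha, ih]

lemma cj_SS (a b : ℂ) (ha : a ≠ 0) (f g c : ℂ[X]) (n : ℕ) : SS (cj a b f) (cj a b g) (cj a b c) n ↔ SS f g c n := by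
  have key : ∀ (p : ℂ[X]) x, (fun y => (cj a b p).eval y)^[n] x = (cj a b c).eval x ↔
      (fun y => p.eval y)^[n] (a * x + b) = c.eval (a * x + b) := by
    intro p x
    rw [← cj_iter a b ha p n x, ← cj_eval a b ha c x]
    simp [ha]
  constructor
  · rintro ⟨x, h1, h2⟩
    exact ⟨a * x + b, (key f x).1 h1, (key g x).1 h2⟩
  · rintro ⟨x, h1, h2⟩
    have e : a * ((x - b) / a) + b = x := by field_simp; ring
    refine ⟨(x - b) / a, (key f _).2 ?_, (key g _).2 ?_⟩ <;> rwa [e]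

lemma cj_natDegree (a b : ℂ) (ha : a ≠ 0) (p : ℂ[X]) : (cj a b p).natDegree = p.natDegree := by
  rw [cj, natDegree_C_mul (inv_ne_zero ha), natDegree_sub_C, natDegree_comp, natDegree_linear ha, mul_one]

lemma cj_coeff (a b : ℂ) (p : ℂ[X]) (i : ℕ) (hi : i ≠ 0) :
    (cj a b p).coeff i = a⁻¹ * (p.comp (C a * X + C b)).coeff i := by
  rw [cj, coeff_C_mul, coeff_sub, coeff_C, if_neg hi, sub_zero]

lemma le_case (d : ℕ) (hd : 2 ≤ d) (f g c : ℂ[X]) (hf : f.natDegree = d) (hg : g.natDegree = d)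
    (hle : ‖f.leadingCoeff‖ ≤ ‖g.leadingCoeff‖) : EP (SS f g c) := by
  have hf0 : f.leadingCoeff ≠ 0 := by
    rw [Ne, leadingCoeff_eq_zero]; rintro rfl; simp at hf; omega
  have hdc : (d:ℂ) ≠ 0 := by exact_mod_cast (by omega : d ≠ 0)
  obtain ⟨a, ha⟩ := IsAlgClosed.exists_pow_nat_eq (f.leadingCoeff)⁻¹ (show 0 < d - 1 by omega)
  have ha0 : a ≠ 0 := by
    rintro rfl
    rw [zero_pow (by omega)] at ha
    exact inv_ne_zero hf0 ha.symm
  set b := - f.coeff (d-1) / (d * f.leadingCoeff) with hb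
  have had : a⁻¹ * a ^ d = (f.leadingCoeff)⁻¹ := by
    rw [← ha]
    obtain ⟨k, rfl⟩ : ∃ k, d = k + 1 := ⟨d - 1, by omega⟩
    rw [Nat.add_sub_cancel, pow_succ]; field_simp
  have hlead : ∀ p : ℂ[X], p.natDegree = d → (cj a b p).leadingCoeff = p.leadingCoeff * (f.leadingCoeff)⁻¹ := by
    intro p hp
    rw [leadingCoeff, cj_natDegree a b ha0, hp, cj_coeff _ _ _ _ (by omega), (coeff_aff p d hd hp a b).1, ← had]
    ring
  have := norm_case d hd (cj a b f) (cj a b g) (cj a b c)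
    (by rw [Monic, hlead f hf, mul_inv_cancel₀ hf0]) (by rw [cj_natDegree a b ha0, hf])
    (by
      rw [cj_coeff _ _ _ _ (by omega), (coeff_aff f d hd hf a b).2, hb]
      field_simp; simp)
    (by rw [cj_natDegree a b ha0, hg])
    (by
      rw [hlead g hg, norm_mul, norm_inv, ← div_eq_mul_inv, le_div_iff₀ (norm_pos_iff.2 hf0), one_mul]
      exact hle)
  exact this.of_eventually 0 fun n _ => (cj_SS a b ha0 f g c n).symm

/-- Proposition 4.5: equal-degree case of the generalized dynamical
Mordell–Lang problem for polynomials. -/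
theorem stmt14 (d : ℕ) (hd : 1 < d) (f g c : Polynomial ℂ)
    (hf : f.natDegree = d) (hg : g.natDegree = d) :
    ∃ s : Finset (ℕ × ℕ),
      {n : ℕ | ∃ x : ℂ,
        (fun y => f.eval y)^[n] x = (fun y => g.eval y)^[n] x ∧
        (fun y => g.eval y)^[n] x = c.eval x} =
      ⋃ p ∈ s, {n : ℕ | ∃ k : ℕ, n = p.1 + p.2 * k} := by
  apply EP.ap
  have key : EP (SS f g c) := by
    rcases le_total ‖f.leadingCoeff‖ ‖g.leadingCoeff‖ with h | h
    · exact le_case d hd f g c hf hg h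
    · refine (le_case d hd g f c hg hf h).of_eventually 0 fun n _ => ?_
      exact ⟨fun ⟨x, h1, h2⟩ => ⟨x, h2, h1⟩, fun ⟨x, h1, h2⟩ => ⟨x, h2, h1⟩⟩
  refine key.of_eventually 0 fun n _ => ?_
  exact ⟨fun ⟨x, h1, h2⟩ => ⟨x, h1.trans h2, h2⟩, fun ⟨x, h1, h2⟩ => ⟨x, h1.trans h2.symm, h2⟩⟩
end
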